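/- arXiv:2511.21015 — 12 statements merged into one kernel-verified Lean document; each statement's English description precedes it below -/
import Mathlib

section
/- Let X and Y be finite types, let p be a probability distribution on X and q a probability distribution on Y, and let f : X × Y → ℝ satisfy |f(x,y)| ≤ 1 for all x, y. Define g(x,y) = Σ_{a} p(a) f(a,y) + Σ_{b} q(b) f(x,b) − f(x,y) and μ = E_{p,q}[f]. Fix k ≥ 1 and consider the product probability measure on X^k × Y^k in which the k coordinates x_1,…,x_k are i.i.d. with law p, the k coordinates y_1,…,y_k are i.i.d. with law q, and the two blocks are independent. Let z = (1/k²) Σ_{i=1}^k Σ_{j=1}^k g(x_i, y_j). Then E[z] = μ and E[(z − μ)²] ≤ 16/k². -/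
theorem sum_fin_succ_fun {X : Type*} [Fintype X] (n : ℕ) (F : (Fin (n + 1) → X) → ℝ) :
    ∑ x, F x = ∑ a, ∑ x : Fin n → X, F (Fin.cons a x) := by
  rw [← Fintype.sum_prod_type' (fun a (x : Fin n → X) => F (Fin.cons a x))]
  exact (Equiv.sum_comp (Fin.consEquiv fun _ : Fin (n + 1) => X) F).symm

section

variable {X : Type*} [Fintype X] {p : X → ℝ}

theorem sum_prod_eq_one (hp : ∑ x, p x = 1) (n : ℕ) :
    ∑ x : Fin n → X, ∏ i, p (x i) = 1 := by
  induction n with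
  | zero => simp
  | succ n ih =>
    rw [sum_fin_succ_fun]
    simp [Fin.prod_univ_succ, ← Finset.mul_sum, ih, hp]

theorem sum_prod_mul_sum_eq_zero (hp : ∑ x, p x = 1) {u : X → ℝ} (hu : ∑ x, p x * u x = 0)
    (n : ℕ) : ∑ x : Fin n → X, (∏ i, p (x i)) * ∑ i, u (x i) = 0 := by
  induction n with
  | zero => simp
  | succ n ih =>
    rw [sum_fin_succ_fun]
    have key (a : X) : ∑ x : Fin n → X, (∏ i, p ((Fin.cons a x : Fin (n + 1) → X) i)) *
        ∑ i, u ((Fin.cons a x : Fin (n + 1) → X) i) = p a * u a := by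
      calc
        _ = ∑ x : Fin n → X, (p a * u a * ∏ i, p (x i) +
              p a * ((∏ i, p (x i)) * ∑ i, u (x i))) :=
          Finset.sum_congr rfl fun x _ => by
            simp only [Fin.prod_univ_succ, Fin.sum_univ_succ, Fin.cons_zero, Fin.cons_succ]
            ring
        _ = p a * u a := by
          rw [Finset.sum_add_distrib, ← Finset.mul_sum, ← Finset.mul_sum, ih,
            sum_prod_eq_one hp]
          ring
    simp only [key, hu]

/-- The second moment of a sum of i.i.d. centred variables. -/
theorem sum_prod_mul_sum_sq (hp : ∑ x, p x = 1) {u : X → ℝ} (hu : ∑ x, p x * u x = 0)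
    (n : ℕ) :
    ∑ x : Fin n → X, (∏ i, p (x i)) * (∑ i, u (x i)) ^ 2 = n * ∑ a, p a * u a ^ 2 := by
  induction n with
  | zero => simp
  | succ n ih =>
    rw [sum_fin_succ_fun]
    have key (a : X) : ∑ x : Fin n → X, (∏ i, p ((Fin.cons a x : Fin (n + 1) → X) i)) *
        (∑ i, u ((Fin.cons a x : Fin (n + 1) → X) i)) ^ 2 =
        p a * u a ^ 2 + p a * (n * ∑ a, p a * u a ^ 2) := by
      calc
        _ = ∑ x : Fin n → X, (p a * u a ^ 2 * ∏ i, p (x i) +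
              2 * p a * u a * ((∏ i, p (x i)) * ∑ i, u (x i)) +
              p a * ((∏ i, p (x i)) * (∑ i, u (x i)) ^ 2)) :=
          Finset.sum_congr rfl fun x _ => by
            simp only [Fin.prod_univ_succ, Fin.sum_univ_succ, Fin.cons_zero, Fin.cons_succ]
            ring
        _ = _ := by
          rw [Finset.sum_add_distrib, Finset.sum_add_distrib, ← Finset.mul_sum,
            ← Finset.mul_sum, ← Finset.mul_sum, ih, sum_prod_eq_one hp,
            sum_prod_mul_sum_eq_zero hp hu]
          ring
    simp only [key, Finset.sum_add_distrib, ← Finset.sum_mul, hp]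
    push_cast
    ring

theorem abs_sum_mul_le_one (hp0 : ∀ x, 0 ≤ p x) (hp : ∑ x, p x = 1) {u : X → ℝ}
    (hu : ∀ x, |u x| ≤ 1) : |∑ x, p x * u x| ≤ 1 := by
  calc
    |∑ x, p x * u x| ≤ ∑ x, |p x * u x| := Finset.abs_sum_le_sum_abs _ _
    _ ≤ ∑ x, p x := Finset.sum_le_sum fun x _ => by
      rw [abs_mul, abs_of_nonneg (hp0 x)]
      exact mul_le_of_le_one_right (hp0 x) (hu x)
    _ = 1 := hp

end

/-- The second moment of a sum over a grid of a kernel centred in each variable. -/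
theorem sum_sum_prod_mul_sum_sq {X Y : Type*} [Fintype X] [Fintype Y] {p : X → ℝ} {q : Y → ℝ}
    (hp : ∑ x, p x = 1) (hq : ∑ y, q y = 1) {h : X → Y → ℝ}
    (hX : ∀ y, ∑ x, p x * h x y = 0) (hY : ∀ x, ∑ y, q y * h x y = 0) (m n : ℕ) :
    ∑ x : Fin m → X, ∑ y : Fin n → Y,
      (∏ i, p (x i)) * (∏ j, q (y j)) * (∑ i, ∑ j, h (x i) (y j)) ^ 2 =
    m * n * ∑ a, p a * ∑ b, q b * h a b ^ 2 := by
  have hrow (y : Fin n → Y) : ∑ a, p a * ∑ j, h a (y j) = 0 := by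
    simp only [Finset.mul_sum]
    rw [Finset.sum_comm]
    simp [hX]
  calc
    _ = ∑ y : Fin n → Y, (∏ j, q (y j)) *
          ∑ x : Fin m → X, (∏ i, p (x i)) * (∑ i, ∑ j, h (x i) (y j)) ^ 2 := by
      rw [Finset.sum_comm]
      simp only [Finset.mul_sum]
      exact Finset.sum_congr rfl fun y _ => Finset.sum_congr rfl fun x _ => by ring
    _ = ∑ y : Fin n → Y, (∏ j, q (y j)) * (m * ∑ a, p a * (∑ j, h a (y j)) ^ 2) :=
      Finset.sum_congr rfl fun y _ => by rw [sum_prod_mul_sum_sq hp (hrow y)]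
    _ = m * ∑ a, p a * ∑ y : Fin n → Y, (∏ j, q (y j)) * (∑ j, h a (y j)) ^ 2 := by
      simp only [Finset.mul_sum]
      rw [Finset.sum_comm]
      exact Finset.sum_congr rfl fun y _ => Finset.sum_congr rfl fun x _ => by ring
    _ = m * ∑ a, p a * (n * ∑ b, q b * h a b ^ 2) := by
      simp only [sum_prod_mul_sum_sq hq (hY _)]
    _ = _ := by
      rw [mul_assoc, Finset.mul_sum Finset.univ _ (n : ℝ)]
      congr 1
      exact Finset.sum_congr rfl fun a _ => by ring

theorem sum_sum_prod_mul_sum_eq_zero {X Y : Type*} [Fintype X] [Fintype Y] {p : X → ℝ}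
    {q : Y → ℝ} (hp : ∑ x, p x = 1) {h : X → Y → ℝ} (hX : ∀ y, ∑ x, p x * h x y = 0) (m n : ℕ) :
    ∑ x : Fin m → X, ∑ y : Fin n → Y,
      (∏ i, p (x i)) * (∏ j, q (y j)) * ∑ i, ∑ j, h (x i) (y j) = 0 := by
  have hrow (y : Fin n → Y) : ∑ a, p a * ∑ j, h a (y j) = 0 := by
    simp only [Finset.mul_sum]
    rw [Finset.sum_comm]
    simp [hX]
  rw [Finset.sum_comm]
  refine Finset.sum_eq_zero fun y _ => ?_
  calc
    _ = (∏ j, q (y j)) * ∑ x : Fin m → X, (∏ i, p (x i)) * ∑ i, ∑ j, h (x i) (y j) := by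
      rw [Finset.mul_sum]
      exact Finset.sum_congr rfl fun x _ => by ring
    _ = 0 := by rw [sum_prod_mul_sum_eq_zero hp (hrow y), mul_zero]

theorem stmt_1 {X Y : Type*} [Fintype X] [Fintype Y]
    (p : X → ℝ) (q : Y → ℝ)
    (hp0 : ∀ x, 0 ≤ p x) (hp1 : ∑ x, p x = 1)
    (hq0 : ∀ y, 0 ≤ q y) (hq1 : ∑ y, q y = 1)
    (f : X × Y → ℝ) (hf : ∀ x y, |f (x, y)| ≤ 1)
    (g : X → Y → ℝ) (μ : ℝ)
    (hg : ∀ x y, g x y = (∑ a, p a * f (a, y)) + (∑ b, q b * f (x, b)) - f (x, y))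
    (hμ : μ = ∑ x, ∑ y, p x * q y * f (x, y))
    (k : ℕ) (hk : 1 ≤ k)
    (z : (Fin k → X) → (Fin k → Y) → ℝ)
    (hz : ∀ x y, z x y = (1 / (k : ℝ) ^ 2) * ∑ i, ∑ j, g (x i) (y j)) :
    (∑ x : Fin k → X, ∑ y : Fin k → Y,
        (∏ i, p (x i)) * (∏ j, q (y j)) * z x y) = μ ∧
    (∑ x : Fin k → X, ∑ y : Fin k → Y,
        (∏ i, p (x i)) * (∏ j, q (y j)) * (z x y - μ) ^ 2) ≤ 16 / (k : ℝ) ^ 2 := by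
  have hk0 : (k : ℝ) ≠ 0 := by positivity
  have hμX : μ = ∑ x, p x * ∑ y, q y * f (x, y) := by
    simp only [hμ, Finset.mul_sum, mul_assoc]
  have hμY : μ = ∑ y, q y * ∑ x, p x * f (x, y) := by
    rw [hμ, Finset.sum_comm]
    simp only [Finset.mul_sum]
    exact Finset.sum_congr rfl fun y _ => Finset.sum_congr rfl fun x _ => by ring
  have hX (y : Y) : ∑ x, p x * (g x y - μ) = 0 := by
    simp only [hg, mul_sub, mul_add, Finset.sum_sub_distrib, Finset.sum_add_distrib,
      ← Finset.sum_mul, hp1, ← hμX]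
    ring
  have hY (x : X) : ∑ y, q y * (g x y - μ) = 0 := by
    simp only [hg, mul_sub, mul_add, Finset.sum_sub_distrib, Finset.sum_add_distrib,
      ← Finset.sum_mul, hq1, ← hμY]
    ring
  have hA (y : Y) : |∑ a, p a * f (a, y)| ≤ 1 := abs_sum_mul_le_one hp0 hp1 fun a => hf a y
  have hB (x : X) : |∑ b, q b * f (x, b)| ≤ 1 := abs_sum_mul_le_one hq0 hq1 fun b => hf x b
  have hM : |μ| ≤ 1 := hμX ▸ abs_sum_mul_le_one hp0 hp1 hB
  have hsq (x : X) (y : Y) : (g x y - μ) ^ 2 ≤ 16 := by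
    have h₁ := abs_le.1 (hA y)
    have h₂ := abs_le.1 (hB x)
    have h₃ := abs_le.1 (hf x y)
    have h₄ := abs_le.1 hM
    have := hg x y
    nlinarith
  have hzμ (x : Fin k → X) (y : Fin k → Y) :
      z x y - μ = (1 / (k : ℝ) ^ 2) * ∑ i, ∑ j, (g (x i) (y j) - μ) := by
    simp only [hz, Finset.sum_sub_distrib, Finset.sum_const, Finset.card_univ, Fintype.card_fin,
      nsmul_eq_mul]
    field_simp
  constructor
  · calc
      _ = ∑ x : Fin k → X, ∑ y : Fin k → Y, ((1 / (k : ℝ) ^ 2) *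
            ((∏ i, p (x i)) * (∏ j, q (y j)) * ∑ i, ∑ j, (g (x i) (y j) - μ)) +
            (∏ i, p (x i)) * ((∏ j, q (y j)) * μ)) :=
        Finset.sum_congr rfl fun x _ => Finset.sum_congr rfl fun y _ => by
          rw [eq_add_of_sub_eq (hzμ x y)]
          ring
      _ = μ := by
        simp only [Finset.sum_add_distrib, ← Finset.mul_sum, ← Finset.sum_mul,
          sum_prod_eq_one hp1, sum_prod_eq_one hq1]
        rw [sum_sum_prod_mul_sum_eq_zero hp1 hX]
        ring
  · calc
      _ = (1 / (k : ℝ) ^ 2) ^ 2 * ∑ x : Fin k → X, ∑ y : Fin k → Y,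
            (∏ i, p (x i)) * (∏ j, q (y j)) * (∑ i, ∑ j, (g (x i) (y j) - μ)) ^ 2 := by
        simp only [Finset.mul_sum Finset.univ _ ((1 / (k : ℝ) ^ 2) ^ 2), hzμ]
        exact Finset.sum_congr rfl fun x _ => Finset.sum_congr rfl fun y _ => by ring
      _ = (1 / (k : ℝ) ^ 2) * ∑ a, p a * ∑ b, q b * (g a b - μ) ^ 2 := by
        rw [sum_sum_prod_mul_sum_sq hp1 hq1 hX hY]
        field_simp
      _ ≤ (1 / (k : ℝ) ^ 2) * ∑ a, p a * ∑ b, q b * 16 := by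
        gcongr with a _ b _
        · exact hp0 a
        · exact hq0 b
        · exact hsq a b
      _ = 16 / (k : ℝ) ^ 2 := by
        simp only [← Finset.sum_mul, hp1, hq1]
        ring
end

section
/- Let ι be a finite type, let p and q be probability distributions on ι, and let ε ≥ 0. Define p^ε : ι → ℝ by p^ε(x) = p(x) if p(x) ≥ ε and p^ε(x) = 0 otherwise, and define q^ε analogously. Then Σ_{x∈ι} p(x) q(x) ≤ Σ_{x∈ι} p^ε(x) q^ε(x) + 2ε. -/
theorem stmt_2 {ι : Type*} [Fintype ι]
    (p q : ι → ℝ)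
    (hp0 : ∀ x, 0 ≤ p x) (hp1 : ∑ x, p x = 1)
    (hq0 : ∀ x, 0 ≤ q x) (hq1 : ∑ x, q x = 1)
    (ε : ℝ) (hε : 0 ≤ ε)
    (pε qε : ι → ℝ)
    (hpε : ∀ x, pε x = if ε ≤ p x then p x else 0)
    (hqε : ∀ x, qε x = if ε ≤ q x then q x else 0) :
    ∑ x, p x * q x ≤ (∑ x, pε x * qε x) + 2 * ε := by
  have h_sum : ∑ x, (pε x * qε x + ε * (p x + q x)) = (∑ x, pε x * qε x) + 2 * ε := by
    rw [Finset.sum_add_distrib, ← Finset.mul_sum, Finset.sum_add_distrib, hp1, hq1]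
    ring
  rw [← h_sum]
  refine Finset.sum_le_sum fun x _ => ?_
  have hεp := mul_nonneg hε (hp0 x)
  have hεq := mul_nonneg hε (hq0 x)
  rw [hpε, hqε]
  by_cases hp : ε ≤ p x
  · by_cases hq : ε ≤ q x
    · rw [if_pos hp, if_pos hq]
      linarith
    · have := mul_le_mul_of_nonneg_left (not_le.mp hq).le (hp0 x)
      rw [if_neg hq]
      linarith
  · have := mul_le_mul_of_nonneg_right (not_le.mp hp).le (hq0 x)
    rw [if_neg hp]
    linarith
end

section
/- Let μ be an atomless (nonatomic) probability measure on ℝ whose support is contained in [0,1], and let β ∈ (0,1]. Then there exist an integer m with 1 ≤ m ≤ 2⌈1/β⌉ + 1 and points 0 = a_0 ≤ a_1 ≤ ⋯ ≤ a_m = 1 such that for every j ∈ {1,…,m} one has a_j − a_{j−1} ≤ β and μ((a_{j−1}, a_j]) ≤ β. -/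
open MeasureTheory

theorem continuous_cdf_of_nullSingletonClass (μ : Measure ℝ) [IsProbabilityMeasure μ]
    [NullSingletonClass μ] :
    Continuous (ProbabilityTheory.cdf μ) := by
  rw [continuous_iff_continuousAt]
  intro x
  rw [(ProbabilityTheory.monotone_cdf μ).continuousAt_iff_leftLim_eq_rightLim,
    StieltjesFunction.rightLim_eq]
  have h := (ProbabilityTheory.cdf μ).measure_singleton x
  rw [ProbabilityTheory.measure_cdf, measure_singleton, eq_comm, ENNReal.ofReal_eq_zero] at h
  exact le_antisymm ((ProbabilityTheory.monotone_cdf μ).leftLim_le le_rfl) (by linarith)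

theorem stmt_3 (μ : Measure ℝ) [IsProbabilityMeasure μ]
    (hatom : ∀ x : ℝ, μ {x} = 0)
    (hsupp : μ (Set.Icc (0:ℝ) 1)ᶜ = 0)
    (β : ℝ) (hβ0 : 0 < β) (hβ1 : β ≤ 1) :
    ∃ (m : ℕ) (a : ℕ → ℝ),
      1 ≤ m ∧ m ≤ 2 * ⌈1 / β⌉₊ + 1 ∧
      a 0 = 0 ∧ a m = 1 ∧
      (∀ j < m, a j ≤ a (j + 1)) ∧
      (∀ j, 1 ≤ j → j ≤ m →
        a j - a (j - 1) ≤ β ∧ μ (Set.Ioc (a (j - 1)) (a j)) ≤ ENNReal.ofReal β) := by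
  have : NullSingletonClass μ := ⟨hatom⟩
  set F := ProbabilityTheory.cdf μ with hF
  have hmono : Monotone F := ProbabilityTheory.monotone_cdf μ
  have hF0 : F 0 = 0 := by
    rw [hF, ProbabilityTheory.cdf_eq_real, measureReal_def, ← Set.Iio_union_right,
      measure_union_null (measure_mono_null (fun x hx => ?_) hsupp) (hatom 0), ENNReal.toReal_zero]
    exact fun h => not_lt.2 h.1 hx
  have hF1 : F 1 = 1 := by
    have h : μ (Set.Iic 1)ᶜ = 0 :=
      measure_mono_null (Set.compl_subset_compl.2 fun x hx => hx.2) hsupp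
    rw [hF, ProbabilityTheory.cdf_eq_real, measureReal_def,
      (prob_compl_eq_zero_iff measurableSet_Iic).1 h, ENNReal.toReal_one]
  -- The points are the level points of the strictly increasing function `x + F x`.
  have hG : StrictMono fun x => x + F x := strictMono_id.add_monotone hmono
  have hsurj : ∀ j : ℕ, ∃ x, x + F x = min (j * β) 2 := fun j => by
    have hivt := intermediate_value_Icc (zero_le_one' ℝ)
      (continuous_id.add (continuous_cdf_of_nullSingletonClass μ)).continuousOn
    obtain ⟨x, -, hx⟩ := hivt (show min (j * β) 2 ∈ _ from
      ⟨by simp only [Pi.add_apply, id, ← hF, hF0, add_zero]; positivity,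
       by simp only [Pi.add_apply, id, ← hF, hF1]; exact (min_le_right _ _).trans (by norm_num)⟩)
    exact ⟨x, hx⟩
  choose a ha using hsurj
  have hstep : ∀ j, a j ≤ a (j + 1) := fun j => hG.le_iff_le.1 <| by
    simp only [ha]
    gcongr
    simp
  have hceil : 1 ≤ ⌈1 / β⌉₊ * β := (div_le_iff₀ hβ0).1 (Nat.le_ceil (1 / β))
  have hpos : 0 < ⌈1 / β⌉₊ := Nat.ceil_pos.2 (by positivity)
  refine ⟨2 * ⌈1 / β⌉₊, a, by lia, by lia, hG.injective ?_, hG.injective ?_,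
    fun j _ => hstep j, ?_⟩
  · simp [ha, hF0]
  · simp only [ha, hF1]
    push_cast
    rw [min_eq_right (by linarith)]
    norm_num
  · rintro (_ | j) hj -
    · lia
    rw [Nat.add_sub_cancel]
    have hinc : a (j + 1) + F (a (j + 1)) ≤ a j + F (a j) + β := by
      rw [ha, ha, ← min_add_add_right]
      push_cast
      exact min_le_min (by linarith) (by linarith)
    have hFstep := hmono (hstep j)
    have hastep := hstep j
    refine ⟨by linarith, ?_⟩
    rw [← ProbabilityTheory.measure_cdf μ, StieltjesFunction.measure_Ioc]
    exact ENNReal.ofReal_le_ofReal (by linarith)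
end

section
/- Let f : [0,1] → ℝ be convex on [0,1], 1-Lipschitz on [0,1], and satisfy |f(x)| ≤ 1 for all x ∈ [0,1]. Then there exist a probability measure D on ℝ supported in [0,1] and a constant c ∈ [−2,2] such that f(x) = c + ∫ |x − z| dD(z) for all x ∈ [0,1]. -/
open MeasureTheory

open Set Filter Topology

/-- The increment of the potential `x ↦ ∫ |x - z| ∂D` is the integral of its derivative
`t ↦ 2 D(-∞, t] - 1`. -/
lemma intervalIntegral_two_mul_measureReal_Iic_sub_one (D : Measure ℝ) [IsProbabilityMeasure D]
    {a b : ℝ} (hab : a ≤ b) (ha : Integrable (fun z => |a - z|) D)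
    (hb : Integrable (fun z => |b - z|) D) :
    ∫ t in a..b, (2 * D.real (Iic t) - 1) = ∫ z, |b - z| ∂D - ∫ z, |a - z| ∂D := by
  let s : ℝ → ℝ → ℝ := fun t z => if z ≤ t then 1 else -1
  have hs_outer (t : ℝ) : ∫ z, s t z ∂D = 2 * D.real (Iic t) - 1 := by
    have h : s t = fun z => (Iic t).indicator (fun _ => (2 : ℝ)) z - 1 := by
      ext z
      by_cases hz : z ≤ t <;> norm_num [s, hz]
    rw [h, integral_sub ((integrable_const _).indicator measurableSet_Iic) (integrable_const _),
      integral_indicator_const _ measurableSet_Iic]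
    simp [mul_comm]
  have hs_inner (z : ℝ) : ∫ t in a..b, s t z = |b - z| - |a - z| := by
    refine intervalIntegral.integral_eq_sub_of_hasDeriv_right_of_le
      (f := fun t => |t - z|) hab (by fun_prop) (fun t _ => ?_) ?_
    · by_cases hz : z ≤ t
      · simp only [s, hz, if_true]
        refine ((hasDerivWithinAt_id t _).sub_const z).congr (fun y hy => ?_) ?_
        · exact abs_of_nonneg (sub_nonneg.2 (hz.trans (le_of_lt hy)))
        · exact abs_of_nonneg (sub_nonneg.2 hz)
      · simp only [s, hz, if_false]
        have hz : t < z := not_le.1 hz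
        refine HasDerivAt.hasDerivWithinAt ?_
        refine ((hasDerivAt_id t).sub_const z).neg.congr_of_eventuallyEq ?_
        filter_upwards [eventually_lt_nhds hz] with y hy
        exact abs_of_neg (sub_neg.2 hy)
    · refine Monotone.intervalIntegrable fun t u htu => ?_
      dsimp only [s]
      split_ifs <;> linarith
  have hs_meas : Measurable (Function.uncurry s) :=
    Measurable.ite (measurableSet_le measurable_snd measurable_fst) measurable_const
      measurable_const
  have : IsFiniteMeasure (volume.restrict (uIoc a b)) :=
    inferInstanceAs (IsFiniteMeasure (volume.restrict (Ioc (min a b) (max a b))))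
  have hs_int : Integrable (Function.uncurry s) ((volume.restrict (uIoc a b)).prod D) := by
    refine Integrable.of_bound hs_meas.aestronglyMeasurable 1 (ae_of_all _ fun p => ?_)
    simp only [Function.uncurry, s]
    split_ifs <;> simp
  simp_rw [← hs_outer]
  rw [intervalIntegral_integral_swap hs_int, ← integral_sub hb ha]
  simp_rw [hs_inner]

/-- A monotone function that is `0` on the negative reals and `1` on `[1, ∞)` agrees almost
everywhere with the distribution function of a probability measure on `[0, 1]`. -/
lemma Monotone.exists_isProbabilityMeasure_Icc {G : ℝ → ℝ} (hG : Monotone G)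
    (hG0 : ∀ x < 0, G x = 0) (hG1 : ∀ x, 1 ≤ x → G x = 1) :
    ∃ D : Measure ℝ, IsProbabilityMeasure D ∧ D (Icc (0 : ℝ) 1)ᶜ = 0 ∧
      ∀ᵐ t, D.real (Iic t) = G t := by
  let F := hG.stieltjesFunction
  have hF0 (x : ℝ) (hx : x < 0) : F x = 0 := by
    refine rightLim_eq_of_tendsto (tendsto_const_nhds.congr' ?_)
    filter_upwards [mem_nhdsWithin_of_mem_nhds (Iio_mem_nhds hx)] with y hy using (hG0 y hy).symm
  have hF1 (x : ℝ) (hx : 1 ≤ x) : F x = 1 := by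
    refine rightLim_eq_of_tendsto (tendsto_const_nhds.congr' ?_)
    filter_upwards [self_mem_nhdsWithin] with y hy using (hG1 y (hx.trans (le_of_lt hy))).symm
  have hbot : Tendsto F atBot (𝓝 0) := by
    refine tendsto_const_nhds.congr' ?_
    filter_upwards [eventually_lt_atBot 0] with y hy using (hF0 y hy).symm
  have htop : Tendsto F atTop (𝓝 1) := by
    refine tendsto_const_nhds.congr' ?_
    filter_upwards [eventually_ge_atTop 1] with y hy using (hF1 y hy).symm
  have hlim : Function.leftLim F 0 = 0 := by
    refine leftLim_eq_of_tendsto (tendsto_const_nhds.congr' ?_)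
    filter_upwards [self_mem_nhdsWithin] with y hy using (hF0 y hy).symm
  have hprob : IsProbabilityMeasure F.measure := F.isProbabilityMeasure hbot htop
  refine ⟨F.measure, hprob, ?_, ?_⟩
  · rw [prob_compl_eq_zero_iff measurableSet_Icc, F.measure_Icc, hlim, hF1 1 le_rfl]
    simp
  · filter_upwards [hG.countable_not_continuousAt.ae_notMem volume] with t ht
    have hFt : F t = G t :=
      hG.continuousWithinAt_Ioi_iff_rightLim_eq.1 (not_not.1 ht).continuousWithinAt
    have hF_nonneg : 0 ≤ F t := F.mono.le_of_tendsto hbot t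
    rw [measureReal_def, F.measure_Iic hbot, sub_zero, ENNReal.toReal_ofReal hF_nonneg, hFt]

lemma LipschitzOnWith.abs_slope_le {f : ℝ → ℝ} {S : Set ℝ} {K : NNReal}
    (hf : LipschitzOnWith K f S) {x y : ℝ} (hx : x ∈ S) (hy : y ∈ S) : |slope f x y| ≤ K := by
  rw [slope_def_field, abs_div]
  exact div_le_of_le_mul₀ (abs_nonneg _) K.2 (hf.dist_le_mul y hy x hx)

/-- The right derivative of a convex Lipschitz function on `[a, b]` is bounded by the Lipschitz
constant in the interior. -/
lemma ConvexOn.abs_rightDeriv_le {f : ℝ → ℝ} {a b : ℝ} {K : NNReal}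
    (hf : ConvexOn ℝ (Icc a b) f) (hK : LipschitzOnWith K f (Icc a b)) {x : ℝ}
    (hx : x ∈ Ioo a b) : |derivWithin f (Ioi x) x| ≤ K := by
  have hxi : x ∈ interior (Icc a b) := by rwa [interior_Icc]
  have hxm := Ioo_subset_Icc_self hx
  have hab : a ≤ b := (hx.1.trans hx.2).le
  refine abs_le.2 ⟨?_, ?_⟩
  · calc -(K : ℝ) ≤ slope f a x := (abs_le.1 (hK.abs_slope_le (left_mem_Icc.2 hab) hxm)).1
      _ ≤ derivWithin f (Iio x) x :=
        hf.slope_le_leftDeriv_of_mem_interior (left_mem_Icc.2 hab) hxi hx.1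
      _ ≤ _ := hf.leftDeriv_le_rightDeriv_of_mem_interior hxi
  · exact (hf.rightDeriv_le_slope_of_mem_interior hxi (right_mem_Icc.2 hab) hx.2).trans
      (abs_le.1 (hK.abs_slope_le hxm (right_mem_Icc.2 hab))).2

theorem stmt_4 (f : ℝ → ℝ)
    (hconv : ConvexOn ℝ (Set.Icc (0:ℝ) 1) f)
    (hlip : LipschitzOnWith 1 f (Set.Icc (0:ℝ) 1))
    (hbd : ∀ x ∈ Set.Icc (0:ℝ) 1, |f x| ≤ 1) :
    ∃ (D : Measure ℝ) (_ : IsProbabilityMeasure D) (c : ℝ),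
      D (Set.Icc (0:ℝ) 1)ᶜ = 0 ∧ c ∈ Set.Icc (-2:ℝ) 2 ∧
      ∀ x ∈ Set.Icc (0:ℝ) 1, f x = c + ∫ z, |x - z| ∂D := by
  let r : ℝ → ℝ := fun x => derivWithin f (Ioi x) x
  have hr_bound (x : ℝ) (h0 : 0 < x) (h1 : x < 1) : -1 ≤ r x ∧ r x ≤ 1 := by
    simpa using abs_le.1 (hconv.abs_rightDeriv_le hlip ⟨h0, h1⟩)
  have hr_mono : MonotoneOn r (Ioo 0 1) := by
    simpa only [interior_Icc] using hconv.monotoneOn_rightDeriv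
  let G : ℝ → ℝ := fun x => if x ≤ 0 then 0 else if 1 ≤ x then 1 else (1 + r x) / 2
  have hG : Monotone G := by
    intro x y hxy
    dsimp only [G]
    split_ifs with hx0 hy0 hy1 hx1 hy0 hy1 hy0 hy1 <;> try linarith
    · linarith [hr_bound y (by linarith) (by linarith)]
    · linarith [hr_bound x (by linarith) (by linarith)]
    · linarith [hr_mono ⟨by linarith, by linarith⟩ ⟨by linarith, by linarith⟩ hxy]
  obtain ⟨D, hD, hsupp, hDG⟩ := hG.exists_isProbabilityMeasure_Icc
    (fun x hx => by simp [G, hx.le]) (fun x hx => by simp [G, hx, zero_lt_one.trans_le hx])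
  have hz : ∀ᵐ z ∂D, z ∈ Icc (0 : ℝ) 1 := hsupp
  have hle (x : ℝ) (hx : x ∈ Icc (0 : ℝ) 1) : ∀ᵐ z ∂D, |x - z| ≤ 1 := by
    filter_upwards [hz] with z hz
    exact abs_le.2 ⟨by linarith [hx.1, hz.2], by linarith [hx.2, hz.1]⟩
  have hint (x : ℝ) (hx : x ∈ Icc (0 : ℝ) 1) : Integrable (fun z => |x - z|) D := by
    refine Integrable.of_bound (by fun_prop) 1 ?_
    simpa using hle x hx
  have h0 : (0 : ℝ) ∈ Icc (0 : ℝ) 1 := by simp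
  have hI_nonneg : 0 ≤ ∫ z, |0 - z| ∂D := integral_nonneg fun z => abs_nonneg _
  have hI_le : ∫ z, |0 - z| ∂D ≤ 1 := by
    simpa using integral_mono_ae (hint 0 h0) (integrable_const 1) (hle 0 h0)
  have hf0 := abs_le.1 (hbd 0 h0)
  refine ⟨D, hD, f 0 - ∫ z, |0 - z| ∂D, hsupp, ⟨by linarith, by linarith⟩, fun x hx => ?_⟩
  have hpot := intervalIntegral_two_mul_measureReal_Iic_sub_one D hx.1 (hint 0 h0) (hint x hx)
  have hcongr : ∫ t in (0 : ℝ)..x, (2 * D.real (Iic t) - 1) = ∫ t in (0 : ℝ)..x, (2 * G t - 1) :=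
    intervalIntegral.integral_congr_ae <| by
      filter_upwards [hDG] with t ht _
      rw [ht]
  have hftc : ∫ t in (0 : ℝ)..x, (2 * G t - 1) = f x - f 0 := by
    refine intervalIntegral.integral_eq_sub_of_hasDeriv_right_of_le hx.1
      (hlip.continuousOn.mono (Icc_subset_Icc_right hx.2)) (fun t ht => ?_)
      ((hG.intervalIntegrable.const_mul 2).sub intervalIntegrable_const)
    have ht1 : t < 1 := ht.2.trans_le hx.2
    have hGt : 2 * G t - 1 = r t := by
      simp only [G, not_le.2 ht.1, not_le.2 ht1, if_false]
      ring
    rw [hGt]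
    exact hconv.hasDerivWithinAt_rightDeriv_of_mem_interior
      (by rw [interior_Icc]; exact ⟨ht.1, ht1⟩)
  linarith
end

section
/- For every natural number k ≥ 1 there exists a constant C > 0 (depending only on k) with the following property: if f : ℝ² → ℝ is k-times continuously differentiable on a neighborhood of [0,1]², satisfies |f(x,y)| ≤ 1 for all (x,y) ∈ [0,1]², and satisfies |∂_x^i ∂_y^{k−i} f(x,y)| ≤ 1 for all 0 ≤ i ≤ k and all (x,y) ∈ [0,1]², then for every ℓ with 0 ≤ ℓ ≤ k and every 0 ≤ i ≤ ℓ one has |∂_x^i ∂_y^{ℓ−i} f(x,y)| ≤ C for all (x,y) ∈ [0,1]². -/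
/-- The mixed partial derivative `∂_x^i ∂_y^j f`, taken `i` times in the first
variable and `j` times in the second variable. -/
noncomputable def pdxy (i j : ℕ) (f : ℝ → ℝ → ℝ) (x y : ℝ) : ℝ :=
  iteratedDeriv i (fun x' => iteratedDeriv j (fun y' => f x' y') y) x

theorem exists_abs_le_of_hasDerivAt_chain (A : ℝ) (j : ℕ) :
    ∀ L : ℝ, 0 < L → ∃ D : ℝ, ∀ (G : ℕ → ℝ → ℝ) (a : ℝ),
      (∀ i < j, ∀ x ∈ Set.Icc a (a + L), HasDerivAt (G i) (G (i + 1) x) x) →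
      (∀ x ∈ Set.Icc a (a + L), |G 0 x| ≤ A) →
      ∃ ξ ∈ Set.Icc a (a + L), |G j ξ| ≤ D := by
  induction j with
  | zero =>
    intro L hL
    exact ⟨A, fun G a _ h => ⟨a, ⟨le_rfl, by linarith⟩, h a ⟨le_rfl, by linarith⟩⟩⟩
  | succ j ih =>
    intro L hL
    obtain ⟨D, hD⟩ := ih (L / 3) (by positivity)
    refine ⟨2 * D / (L / 3), fun G a hG h0 => ?_⟩
    obtain ⟨p, ⟨hp1, hp2⟩, hp⟩ := hD G a
      (fun i hi x hx => hG i (by omega) x ⟨hx.1, by linarith [hx.2]⟩)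
      (fun x hx => h0 x ⟨hx.1, by linarith [hx.2]⟩)
    obtain ⟨q, ⟨hq1, hq2⟩, hq⟩ := hD G (a + 2 * L / 3)
      (fun i hi x hx => hG i (by omega) x ⟨by linarith [hx.1], by linarith [hx.2]⟩)
      (fun x hx => h0 x ⟨by linarith [hx.1], by linarith [hx.2]⟩)
    have hd : ∀ x ∈ Set.Icc p q, HasDerivAt (G j) (G (j + 1) x) x := fun x hx =>
      hG j (by omega) x ⟨by linarith [hx.1], by linarith [hx.2]⟩
    obtain ⟨ξ, hξ, he⟩ := exists_hasDerivAt_eq_slope (G j) (G (j + 1)) (by linarith : p < q)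
      (fun x hx => (hd x hx).continuousAt.continuousWithinAt)
      (fun x hx => hd x (Set.Ioo_subset_Icc_self hx))
    refine ⟨ξ, ⟨by linarith [hξ.1], by linarith [hξ.2]⟩, ?_⟩
    rw [he, abs_div, abs_of_pos (by linarith : 0 < q - p)]
    have hD0 : 0 ≤ D := (abs_nonneg _).trans hp
    have hnum : |G j q - G j p| ≤ 2 * D := (abs_sub _ _).trans (by linarith)
    exact div_le_div₀ (by linarith) hnum (by positivity) (by linarith)

theorem exists_bound_of_hasDerivAt_chain (m : ℕ) :
    ∀ A B : ℝ, ∃ C : ℝ, ∀ G : ℕ → ℝ → ℝ,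
      (∀ i < m, ∀ x ∈ Set.Icc (0 : ℝ) 1, HasDerivAt (G i) (G (i + 1) x) x) →
      (∀ x ∈ Set.Icc (0 : ℝ) 1, |G 0 x| ≤ A) →
      (∀ x ∈ Set.Icc (0 : ℝ) 1, |G m x| ≤ B) →
      ∀ j ≤ m, ∀ x ∈ Set.Icc (0 : ℝ) 1, |G j x| ≤ C := by
  induction m with
  | zero =>
    intro A B
    refine ⟨A, fun G _ h _ j hj => ?_⟩
    obtain rfl : j = 0 := by omega
    exact h
  | succ m ih =>
    intro A B
    obtain ⟨D, hD⟩ := exists_abs_le_of_hasDerivAt_chain A m 1 one_pos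
    obtain ⟨C, hC⟩ := ih A (D + B)
    refine ⟨max C B, fun G hG h0 h1 j hj x hx => ?_⟩
    rcases hj.lt_or_eq with hj | rfl
    · refine (hC G (fun i hi => hG i (by omega)) h0 (fun y hy => ?_) j (by omega) x hx).trans
        (le_max_left _ _)
      obtain ⟨ξ, hξ, hb⟩ := hD G 0 (by simpa using fun i hi => hG i (Nat.lt_succ_of_lt hi))
        (by simpa using h0)
      rw [zero_add] at hξ
      have hmv := (convex_Icc (0 : ℝ) 1).norm_image_sub_le_of_norm_hasDerivWithin_le
        (fun z hz => (hG m (by omega) z hz).hasDerivWithinAt) h1 hξ hy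
      rw [Real.norm_eq_abs, Real.norm_eq_abs] at hmv
      have hB : 0 ≤ B := (abs_nonneg _).trans (h1 y hy)
      have hle : |y - ξ| ≤ 1 := abs_le.2 ⟨by linarith [hy.1, hξ.2], by linarith [hy.2, hξ.1]⟩
      have htri := abs_add_le (G m ξ) (G m y - G m ξ)
      rw [add_sub_cancel] at htri
      nlinarith
    · exact (h1 x hx).trans (le_max_right _ _)

theorem ContDiffAt.hasDerivAt_iteratedDeriv {g : ℝ → ℝ} {x : ℝ} {n : ℕ}
    (hg : ContDiffAt ℝ n g x) {i : ℕ} (hi : i < n) :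
    HasDerivAt (iteratedDeriv i g) (iteratedDeriv (i + 1) g x) x := by
  rw [iteratedDeriv_succ]
  refine DifferentiableAt.hasDerivAt ?_
  rw [← differentiableWithinAt_univ, ← iteratedDerivWithin_univ]
  exact hg.contDiffWithinAt.differentiableWithinAt_iteratedDerivWithin (mod_cast hi)
    (by simp [uniqueDiffOn_univ])

theorem contDiffOn_iteratedDeriv_snd {f : ℝ → ℝ → ℝ} {U : Set (ℝ × ℝ)} (hU : IsOpen U)
    {j n : ℕ} (hf : ContDiffOn ℝ (n + j : ℕ) (fun p : ℝ × ℝ => f p.1 p.2) U) :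
    ContDiffOn ℝ n (fun p : ℝ × ℝ => iteratedDeriv j (fun y => f p.1 y) p.2) U := by
  induction j generalizing n with
  | zero => simpa using hf
  | succ j ih =>
    have h := ih (n := n + 1) (by convert hf using 2; ring)
    have h' := (h.fderiv_of_isOpen (m := n) hU (by norm_cast)).clm_apply
      (contDiffOn_const (c := ((0, 1) : ℝ × ℝ)))
    refine h'.congr fun p hp => ?_
    rw [iteratedDeriv_succ]
    have hd := (h.differentiableOn (by simp) p hp).differentiableAt (hU.mem_nhds hp)
    have hc : HasDerivAt (fun y => (p.1, y)) ((0, 1) : ℝ × ℝ) p.2 :=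
      (hasDerivAt_const _ _).prodMk (hasDerivAt_id _)
    exact (hd.hasFDerivAt.comp_hasDerivAt p.2 hc).deriv

theorem stmt_6 (k : ℕ) (hk : 1 ≤ k) :
    ∃ C : ℝ, 0 < C ∧
      ∀ (f : ℝ → ℝ → ℝ) (U : Set (ℝ × ℝ)),
        IsOpen U → (Set.Icc (0:ℝ) 1 ×ˢ Set.Icc (0:ℝ) 1) ⊆ U →
        ContDiffOn ℝ k (fun p : ℝ × ℝ => f p.1 p.2) U →
        (∀ x ∈ Set.Icc (0:ℝ) 1, ∀ y ∈ Set.Icc (0:ℝ) 1, |f x y| ≤ 1) →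
        (∀ i ≤ k, ∀ x ∈ Set.Icc (0:ℝ) 1, ∀ y ∈ Set.Icc (0:ℝ) 1,
          |pdxy i (k - i) f x y| ≤ 1) →
        ∀ ℓ ≤ k, ∀ i ≤ ℓ, ∀ x ∈ Set.Icc (0:ℝ) 1, ∀ y ∈ Set.Icc (0:ℝ) 1,
          |pdxy i (ℓ - i) f x y| ≤ C := by
  obtain ⟨C₁, hC₁⟩ := exists_bound_of_hasDerivAt_chain k 1 1
  choose C₂ hC₂ using fun m => exists_bound_of_hasDerivAt_chain m C₁ 1
  refine ⟨1 + ∑ m ∈ Finset.range (k + 1), |C₂ m|, by positivity, ?_⟩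
  intro f U hU hsub hf h0 htop ℓ hℓ i hi x hx y hy
  have hy_bound : ∀ j ≤ k, ∀ x ∈ Set.Icc (0 : ℝ) 1, ∀ y ∈ Set.Icc (0 : ℝ) 1,
      |iteratedDeriv j (fun y' => f x y') y| ≤ C₁ := by
    intro j hj x hx
    refine hC₁ (fun j => iteratedDeriv j (fun y' => f x y')) (fun i hi y hy => ?_)
      (by simpa using h0 x hx) (fun y hy => by simpa [pdxy] using htop 0 (by omega) x hx y hy) j hj
    have hF := hf.contDiffAt (x := (x, y)) (hU.mem_nhds (hsub ⟨hx, hy⟩))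
    exact (hF.comp y (contDiffAt_const.prodMk contDiffAt_id)).hasDerivAt_iteratedDeriv hi
  obtain ⟨j, rfl⟩ := Nat.exists_eq_add_of_le hi
  rw [Nat.add_sub_cancel_left]
  obtain ⟨n, rfl⟩ : ∃ n, k = n + j := ⟨k - j, by omega⟩
  have hx_bound : |pdxy i j f x y| ≤ C₂ n := by
    refine hC₂ n (fun i x => pdxy i j f x y) (fun i hi x hx => ?_)
      (fun x hx => by simpa [pdxy] using hy_bound j (by omega) x hx y hy)
      (fun x hx => by simpa using htop n (by omega) x hx y hy) i (by omega) x hx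
    have hF := (contDiffOn_iteratedDeriv_snd hU hf).contDiffAt (x := (x, y))
      (hU.mem_nhds (hsub ⟨hx, hy⟩))
    exact (hF.comp x (contDiffAt_id.prodMk contDiffAt_const)).hasDerivAt_iteratedDeriv hi
  have hsum := Finset.single_le_sum (f := fun m => |C₂ m|) (fun m _ => abs_nonneg (C₂ m))
    (Finset.mem_range.2 (by omega : n < n + j + 1))
  linarith [le_abs_self (C₂ n)]
end

section
/- Let Q be a finite type, let Θ be a probability distribution on Q, and let f : Q × Q → ℝ. Let P and R be probability distributions on Q and let C_X, C_Y ≥ 0 be real numbers such that P(x) ≤ 2^{C_X} Θ(x) for all x ∈ Q and R(y) ≤ 2^{C_Y} Θ(y) for all y ∈ Q. Then |Σ_{x∈Q} Σ_{y∈Q} P(x) R(y) f(x,y)| ≤ Disc_Θ(f) · 2^{C_X + C_Y}. -/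
/-- The discrepancy of `f` with respect to the distribution `Θ`: the maximum over all
pairs of subsets `A, B` of `|∑_{x∈A} ∑_{y∈B} Θ x * Θ y * f x y|`. -/
noncomputable def disc {Q : Type*} [Fintype Q] (Θ : Q → ℝ) (f : Q → Q → ℝ) : ℝ :=
  (Finset.univ : Finset (Finset Q × Finset Q)).sup' Finset.univ_nonempty
    fun AB => |∑ x ∈ AB.1, ∑ y ∈ AB.2, Θ x * Θ y * f x y|

theorem sum_mul_le_sum_filter_nonneg {Q : Type*} [Fintype Q] {p w : Q → ℝ} (hp : ∀ x, 0 ≤ p x)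
    (hpw : ∀ x, p x ≤ w x) (g : Q → ℝ) :
    ∑ x, p x * g x ≤ ∑ x with 0 ≤ g x, w x * g x := by
  rw [Finset.sum_filter]
  refine Finset.sum_le_sum fun x _ => ?_
  split_ifs with h
  · exact mul_le_mul_of_nonneg_right (hpw x) h
  · exact mul_nonpos_of_nonneg_of_nonpos (hp x) (not_le.mp h).le

theorem exists_abs_sum_mul_le {Q : Type*} [Fintype Q] {p w : Q → ℝ} (hp : ∀ x, 0 ≤ p x)
    (hpw : ∀ x, p x ≤ w x) (g : Q → ℝ) :
    ∃ A : Finset Q, |∑ x, p x * g x| ≤ |∑ x ∈ A, w x * g x| := by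
  rcases le_total 0 (∑ x, p x * g x) with h | h
  · refine ⟨Finset.univ.filter fun x => 0 ≤ g x, ?_⟩
    rw [abs_of_nonneg h]
    exact (sum_mul_le_sum_filter_nonneg hp hpw g).trans (le_abs_self _)
  · refine ⟨Finset.univ.filter fun x => 0 ≤ -g x, ?_⟩
    have key := sum_mul_le_sum_filter_nonneg hp hpw fun x => -g x
    simp only [mul_neg, Finset.sum_neg_distrib] at key
    rw [abs_of_nonpos h]
    exact key.trans (neg_le_abs _)

theorem abs_sum_le_disc {Q : Type*} [Fintype Q] (Θ : Q → ℝ) (f : Q → Q → ℝ) (A B : Finset Q) :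
    |∑ x ∈ A, ∑ y ∈ B, Θ x * Θ y * f x y| ≤ disc Θ f :=
  Finset.le_sup' (fun AB : Finset Q × Finset Q => |∑ x ∈ AB.1, ∑ y ∈ AB.2, Θ x * Θ y * f x y|)
    (Finset.mem_univ (A, B))

theorem stmt_11 {Q : Type*} [Fintype Q]
    (Θ : Q → ℝ) (hΘ0 : ∀ z, 0 ≤ Θ z) (hΘ1 : ∑ z, Θ z = 1)
    (f : Q → Q → ℝ)
    (P R : Q → ℝ)
    (hP0 : ∀ x, 0 ≤ P x) (hP1 : ∑ x, P x = 1)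
    (hR0 : ∀ y, 0 ≤ R y) (hR1 : ∑ y, R y = 1)
    (CX CY : ℝ) (hCX : 0 ≤ CX) (hCY : 0 ≤ CY)
    (hPd : ∀ x, P x ≤ (2:ℝ) ^ CX * Θ x)
    (hRd : ∀ y, R y ≤ (2:ℝ) ^ CY * Θ y) :
    |∑ x, ∑ y, P x * R y * f x y| ≤ disc Θ f * (2:ℝ) ^ (CX + CY) := by
  obtain ⟨A, hA⟩ := exists_abs_sum_mul_le hP0 hPd fun x => ∑ y, R y * f x y
  obtain ⟨B, hB⟩ := exists_abs_sum_mul_le hR0 hRd fun y => ∑ x ∈ A, (2:ℝ) ^ CX * Θ x * f x y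
  calc |∑ x, ∑ y, P x * R y * f x y|
      = |∑ x, P x * ∑ y, R y * f x y| := by simp only [Finset.mul_sum, mul_assoc]
    _ ≤ |∑ x ∈ A, (2:ℝ) ^ CX * Θ x * ∑ y, R y * f x y| := hA
    _ = |∑ y, R y * ∑ x ∈ A, (2:ℝ) ^ CX * Θ x * f x y| := by
      simp only [Finset.mul_sum]
      rw [Finset.sum_comm]
      simp only [mul_left_comm]
    _ ≤ |∑ y ∈ B, (2:ℝ) ^ CY * Θ y * ∑ x ∈ A, (2:ℝ) ^ CX * Θ x * f x y| := hB
    _ = |(∑ x ∈ A, ∑ y ∈ B, Θ x * Θ y * f x y) * (2:ℝ) ^ (CX + CY)| := by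
      rw [Real.rpow_add two_pos]
      simp only [Finset.mul_sum, Finset.sum_mul]
      rw [Finset.sum_comm]
      congr 1
      refine Finset.sum_congr rfl fun x _ => Finset.sum_congr rfl fun y _ => ?_
      ring
    _ = |∑ x ∈ A, ∑ y ∈ B, Θ x * Θ y * f x y| * (2:ℝ) ^ (CX + CY) := by
      rw [abs_mul, abs_of_pos (Real.rpow_pos_of_pos two_pos _)]
    _ ≤ disc Θ f * (2:ℝ) ^ (CX + CY) :=
      mul_le_mul_of_nonneg_right (abs_sum_le_disc Θ f A B) (Real.rpow_nonneg two_pos.le _)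
end

section
/- Let S and D be finite nonempty types and let P be a probability distribution on S × D, with marginals P_X on S and P_Z on D. For z ∈ D with P_Z(z) > 0, let P_{X|Z=z}(x) = P(x,z)/P_Z(z). For C > 0, call z ∈ D typical if P_Z(z) > 0 and P_{X|Z=z}(x) ≤ |D| · 2^C · P_X(x) for all x ∈ S. Then the P_Z-probability of the set of non-typical z ∈ D with P_Z(z) > 0 is at most 2^{−C}; that is, Σ_{z not typical, P_Z(z)>0} P_Z(z) ≤ 2^{−C}. -/
open scoped Classical in
theorem stmt_12 {S D : Type*} [Fintype S] [Fintype D] [Nonempty S] [Nonempty D]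
    (P : S × D → ℝ) (hP0 : ∀ p, 0 ≤ P p) (hP1 : ∑ p, P p = 1)
    (PX : S → ℝ) (hPX : ∀ x, PX x = ∑ z, P (x, z))
    (PZ : D → ℝ) (hPZ : ∀ z, PZ z = ∑ x, P (x, z))
    (C : ℝ) (hC : 0 < C) :
    ∑ z ∈ Finset.univ.filter (fun z : D =>
        0 < PZ z ∧ ¬ ∀ x, P (x, z) / PZ z ≤ (Fintype.card D : ℝ) * (2:ℝ) ^ C * PX x),
      PZ z ≤ (2:ℝ) ^ (-C) := by
  have hD : (0 : ℝ) < Fintype.card D := by exact_mod_cast Fintype.card_pos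
  have h2 : (0 : ℝ) < 2 ^ C := by positivity
  have hbound : ∀ z, (0 < PZ z ∧
      ¬ ∀ x, P (x, z) / PZ z ≤ (Fintype.card D : ℝ) * (2 : ℝ) ^ C * PX x) →
      PZ z ≤ (2 : ℝ) ^ (-C) / Fintype.card D := by
    rintro z ⟨hz, hnot⟩
    push Not at hnot
    obtain ⟨x, hx⟩ := hnot
    rw [lt_div_iff₀ hz] at hx
    have hle : P (x, z) ≤ PX x := by
      rw [hPX]
      exact Finset.single_le_sum (f := fun z => P (x, z)) (fun z _ => hP0 _) (Finset.mem_univ z)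
    have hPX0 : 0 ≤ PX x := (hP0 _).trans hle
    rw [Real.rpow_neg zero_le_two, le_div_iff₀ hD, ← one_div, le_div_iff₀ h2]
    by_contra! hlt
    nlinarith [mul_le_mul_of_nonneg_right hlt.le hPX0]
  calc
    _ ≤ ∑ z ∈ Finset.univ.filter (fun z : D =>
        0 < PZ z ∧ ¬ ∀ x, P (x, z) / PZ z ≤ (Fintype.card D : ℝ) * (2 : ℝ) ^ C * PX x),
        (2 : ℝ) ^ (-C) / Fintype.card D :=
      Finset.sum_le_sum fun z hz => hbound z (Finset.mem_filter.mp hz).2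
    _ ≤ ∑ _z : D, (2 : ℝ) ^ (-C) / Fintype.card D :=
      Finset.sum_le_sum_of_subset_of_nonneg (Finset.filter_subset _ _)
        fun _ _ _ => by positivity
    _ = (2 : ℝ) ^ (-C) := by
      rw [Finset.sum_const, Finset.card_univ, nsmul_eq_mul, mul_div_cancel₀ _ hD.ne']
end

section
/- Let Q be a finite type, Θ a probability distribution on Q, and k ≥ 0, C > 0 real numbers. Let P be a probability distribution on Q × Q (the joint law of a pair (X₁, X₂)) satisfying P(x₁,x₂) ≤ 2^{2k} Θ(x₁) Θ(x₂) for all x₁, x₂ ∈ Q. Let P₂(x₂) = Σ_{x₁} P(x₁,x₂) be the second marginal and, for x₂ with P₂(x₂) > 0, let P_{1|2=x₂}(x₁) = P(x₁,x₂)/P₂(x₂). Then Σ over those x₂ with P₂(x₂) > 0 for which there exists x₁ with P_{1|2=x₂}(x₁) > 2^{2k + C} Θ(x₁), of P₂(x₂), is at most 2^{−C}. -/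
open scoped Classical in
theorem stmt_13 {Q : Type*} [Fintype Q] [Nonempty Q]
    (Θ : Q → ℝ) (hΘ0 : ∀ z, 0 ≤ Θ z) (hΘ1 : ∑ z, Θ z = 1)
    (k C : ℝ) (hk : 0 ≤ k) (hC : 0 < C)
    (P : Q × Q → ℝ) (hP0 : ∀ p, 0 ≤ P p) (hP1 : ∑ p, P p = 1)
    (hPd : ∀ x₁ x₂, P (x₁, x₂) ≤ (2:ℝ) ^ (2 * k) * Θ x₁ * Θ x₂)
    (P₂ : Q → ℝ) (hP₂ : ∀ x₂, P₂ x₂ = ∑ x₁, P (x₁, x₂)) :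
    ∑ x₂ ∈ Finset.univ.filter (fun x₂ : Q =>
        0 < P₂ x₂ ∧ ∃ x₁, (2:ℝ) ^ (2 * k + C) * Θ x₁ < P (x₁, x₂) / P₂ x₂),
      P₂ x₂ ≤ (2:ℝ) ^ (-C) := by
  have hbad : ∀ x₂ ∈ Finset.univ.filter (fun x₂ : Q =>
      0 < P₂ x₂ ∧ ∃ x₁, (2:ℝ) ^ (2 * k + C) * Θ x₁ < P (x₁, x₂) / P₂ x₂),
      P₂ x₂ ≤ (2:ℝ) ^ (-C) * Θ x₂ := by
    intro x₂ hx₂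
    obtain ⟨-, hpos, x₁, hx₁⟩ := Finset.mem_filter.mp hx₂
    rw [lt_div_iff₀ hpos, Real.rpow_add two_pos] at hx₁
    have hlt : ((2:ℝ) ^ (2 * k) * Θ x₁) * ((2:ℝ) ^ C * P₂ x₂)
        < ((2:ℝ) ^ (2 * k) * Θ x₁) * Θ x₂ := by
      linarith [hPd x₁ x₂]
    have hle : (2:ℝ) ^ C * P₂ x₂ ≤ Θ x₂ :=
      (lt_of_mul_lt_mul_left hlt
        (mul_nonneg (Real.rpow_nonneg zero_le_two _) (hΘ0 x₁))).le
    rw [Real.rpow_neg zero_le_two]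
    exact (le_inv_mul_iff₀ (Real.rpow_pos_of_pos two_pos C)).mpr hle
  calc
    _ ≤ ∑ x₂ ∈ Finset.univ.filter (fun x₂ : Q =>
        0 < P₂ x₂ ∧ ∃ x₁, (2:ℝ) ^ (2 * k + C) * Θ x₁ < P (x₁, x₂) / P₂ x₂),
        (2:ℝ) ^ (-C) * Θ x₂ := Finset.sum_le_sum hbad
    _ ≤ ∑ x₂, (2:ℝ) ^ (-C) * Θ x₂ :=
      Finset.sum_le_sum_of_subset_of_nonneg (Finset.filter_subset _ _) fun x₂ _ _ =>
        mul_nonneg (Real.rpow_nonneg zero_le_two _) (hΘ0 x₂)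
    _ = (2:ℝ) ^ (-C) := by rw [← Finset.mul_sum, hΘ1, mul_one]
end

section
/- Let Q be a finite type, Θ a probability distribution on Q, and f : Q × Q → ℝ with f(x,y) ∈ {−1,1} for all x, y. Let k ≥ 0 be real. Let P be a probability distribution on Q (the law of X) with P(x) ≤ 2^{k} Θ(x) for all x, and let R be a probability distribution on Q × Q (the law of (Y₁,Y₂)), independent of X, with R(y₁,y₂) ≤ 2^{2k} Θ(y₁) Θ(y₂) for all y₁, y₂. Then for every C > 0, |Σ_{x,y₁,y₂} P(x) R(y₁,y₂) f(x,y₁) f(x,y₂)| ≤ 2^{3k + 2C} · Disc_Θ(f) + 3 · 2^{−C}. -/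
/-- A sum against weights `0 ≤ w ≤ c * θ` is controlled by the sums of `θ * g` over subsets. -/
theorem abs_sum_mul_le_of_abs_sum_subset_le {Q : Type*} [Fintype Q] (θ w g : Q → ℝ) {c M : ℝ}
    (hc : 0 ≤ c) (hw0 : ∀ x, 0 ≤ w x) (hw : ∀ x, w x ≤ c * θ x)
    (hM : ∀ A : Finset Q, |∑ x ∈ A, θ x * g x| ≤ M) :
    |∑ x, w x * g x| ≤ c * M := by
  classical
  have upper : ∀ h : Q → ℝ, (∀ A : Finset Q, ∑ x ∈ A, θ x * h x ≤ M) →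
      ∑ x, w x * h x ≤ c * M := by
    intro h hh
    calc ∑ x, w x * h x ≤ ∑ x, if 0 < h x then c * (θ x * h x) else 0 := by
          refine Finset.sum_le_sum fun x _ => ?_
          split_ifs with hx
          · rw [← mul_assoc]
            exact mul_le_mul_of_nonneg_right (hw x) hx.le
          · exact mul_nonpos_of_nonneg_of_nonpos (hw0 x) (not_lt.mp hx)
      _ = c * ∑ x ∈ Finset.univ.filter (fun x => 0 < h x), θ x * h x := by
          rw [← Finset.sum_filter, Finset.mul_sum]
      _ ≤ c * M := mul_le_mul_of_nonneg_left (hh _) hc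
  refine abs_le'.mpr ⟨upper g fun A => (le_abs_self _).trans (hM A), ?_⟩
  have h := upper (fun x => -g x) fun A => by
    simpa using (neg_le_abs _).trans (hM A)
  simpa using h

theorem disc_nonneg {Q : Type*} [Fintype Q] (Θ : Q → ℝ) (f : Q → Q → ℝ) : 0 ≤ disc Θ f :=
  (abs_nonneg _).trans (abs_sum_le_disc Θ f ∅ ∅)

theorem abs_sum_mul_mul_le_disc {Q : Type*} [Fintype Q] (Θ : Q → ℝ) (f : Q → Q → ℝ)
    (u v : Q → ℝ) {a b : ℝ} (ha : 0 ≤ a) (hb : 0 ≤ b)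
    (hu0 : ∀ x, 0 ≤ u x) (hu : ∀ x, u x ≤ a * Θ x)
    (hv0 : ∀ y, 0 ≤ v y) (hv : ∀ y, v y ≤ b * Θ y) :
    |∑ x, u x * ∑ y, v y * f x y| ≤ a * (b * disc Θ f) := by
  refine abs_sum_mul_le_of_abs_sum_subset_le Θ u _ ha hu0 hu fun A => ?_
  have hswap : ∑ x ∈ A, Θ x * ∑ y, v y * f x y = ∑ y, v y * ∑ x ∈ A, Θ x * f x y := by
    simp_rw [Finset.mul_sum]
    rw [Finset.sum_comm]
    exact Finset.sum_congr rfl fun y _ => Finset.sum_congr rfl fun x _ => by ring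
  rw [hswap]
  refine abs_sum_mul_le_of_abs_sum_subset_le Θ v _ hb hv0 hv fun B => ?_
  convert abs_sum_le_disc Θ f A B using 2
  simp_rw [Finset.mul_sum]
  rw [Finset.sum_comm]
  exact Finset.sum_congr rfl fun x _ => Finset.sum_congr rfl fun y _ => by ring

theorem abs_sum_signed_mul_le_disc {Q : Type*} [Fintype Q] (Θ : Q → ℝ) (f : Q → Q → ℝ)
    (u s v : Q → ℝ) {a b : ℝ} (ha : 0 ≤ a) (hb : 0 ≤ b) (hs : ∀ x, |s x| ≤ 1)
    (hu0 : ∀ x, 0 ≤ u x) (hu : ∀ x, u x ≤ a * Θ x)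
    (hv0 : ∀ y, 0 ≤ v y) (hv : ∀ y, v y ≤ b * Θ y) :
    |∑ x, u x * s x * ∑ y, v y * f x y| ≤ 2 * (a * (b * disc Θ f)) := by
  have key : ∀ t : Q → ℝ, (∀ x, |t x| ≤ 1) →
      |∑ x, u x * ((1 + t x) / 2) * ∑ y, v y * f x y| ≤ a * (b * disc Θ f) := fun t ht =>
    abs_sum_mul_mul_le_disc Θ f _ v ha hb
      (fun x => mul_nonneg (hu0 x) (by linarith [(abs_le.mp (ht x)).1]))
      (fun x => (mul_le_of_le_one_right (hu0 x) (by linarith [(abs_le.mp (ht x)).2])).trans (hu x))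
      hv0 hv
  have hsplit : ∑ x, u x * s x * ∑ y, v y * f x y =
      ∑ x, u x * ((1 + s x) / 2) * ∑ y, v y * f x y -
        ∑ x, u x * ((1 + -s x) / 2) * ∑ y, v y * f x y := by
    rw [← Finset.sum_sub_distrib]
    exact Finset.sum_congr rfl fun x _ => by ring
  rw [hsplit]
  refine (abs_sub _ _).trans ?_
  linarith [key s hs, key (fun x => -s x) fun x => (abs_neg (s x)).trans_le (hs x)]

theorem stmt_15 {Q : Type*} [Fintype Q]
    (Θ : Q → ℝ) (hΘ0 : ∀ z, 0 ≤ Θ z) (hΘ1 : ∑ z, Θ z = 1)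
    (f : Q → Q → ℝ) (hf : ∀ x y, f x y = 1 ∨ f x y = -1)
    (k : ℝ) (hk : 0 ≤ k)
    (P : Q → ℝ) (hP0 : ∀ x, 0 ≤ P x) (hP1 : ∑ x, P x = 1)
    (hPd : ∀ x, P x ≤ (2:ℝ) ^ k * Θ x)
    (R : Q × Q → ℝ) (hR0 : ∀ p, 0 ≤ R p) (hR1 : ∑ p, R p = 1)
    (hRd : ∀ y₁ y₂, R (y₁, y₂) ≤ (2:ℝ) ^ (2 * k) * Θ y₁ * Θ y₂) :
    ∀ C : ℝ, 0 < C →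
      |∑ x, ∑ y₁, ∑ y₂, P x * R (y₁, y₂) * f x y₁ * f x y₂|
        ≤ (2:ℝ) ^ (3 * k + 2 * C) * disc Θ f + 3 * (2:ℝ) ^ (-C) := by
  intro C _
  have hfabs : ∀ x y, |f x y| = 1 := fun x y => by
    rcases hf x y with h | h <;> simp [h]
  have hD := disc_nonneg Θ f
  rcases le_or_gt (1 / 2) C with hC | hC
  · have hswap : ∑ x, ∑ y₁, ∑ y₂, P x * R (y₁, y₂) * f x y₁ * f x y₂ =
        ∑ y₂, ∑ x, P x * f x y₂ * ∑ y₁, R (y₁, y₂) * f x y₁ := by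
      rw [Finset.sum_comm (s := (Finset.univ : Finset Q)) (t := Finset.univ)
        (f := fun y₂ x => P x * f x y₂ * ∑ y₁, R (y₁, y₂) * f x y₁)]
      refine Finset.sum_congr rfl fun x _ => ?_
      rw [Finset.sum_comm]
      refine Finset.sum_congr rfl fun y₂ _ => ?_
      rw [Finset.mul_sum]
      exact Finset.sum_congr rfl fun y₁ _ => by ring
    have hpow : (2:ℝ) ^ (3 * k) * 2 ≤ (2:ℝ) ^ (3 * k + 2 * C) := by
      rw [← Real.rpow_add_one two_ne_zero]
      exact Real.rpow_le_rpow_of_exponent_le one_le_two (by linarith)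
    calc |∑ x, ∑ y₁, ∑ y₂, P x * R (y₁, y₂) * f x y₁ * f x y₂|
        ≤ ∑ y₂, |∑ x, P x * f x y₂ * ∑ y₁, R (y₁, y₂) * f x y₁| :=
          hswap ▸ Finset.abs_sum_le_sum_abs _ _
      _ ≤ ∑ y₂, 2 * ((2:ℝ) ^ k * ((2:ℝ) ^ (2 * k) * Θ y₂ * disc Θ f)) :=
          Finset.sum_le_sum fun y₂ _ =>
            abs_sum_signed_mul_le_disc Θ f P (fun x => f x y₂) (fun y₁ => R (y₁, y₂))
              (by positivity) (mul_nonneg (by positivity) (hΘ0 y₂)) (fun x => (hfabs x y₂).le)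
              hP0 hPd (fun y₁ => hR0 _) (fun y₁ => (hRd y₁ y₂).trans_eq (by ring))
      _ = (2:ℝ) ^ (3 * k) * 2 * disc Θ f * ∑ y₂, Θ y₂ := by
          rw [show 3 * k = k + 2 * k by ring, Real.rpow_add two_pos, Finset.mul_sum]
          exact Finset.sum_congr rfl fun y₂ _ => by ring
      _ ≤ (2:ℝ) ^ (3 * k + 2 * C) * disc Θ f := by
          rw [hΘ1, mul_one]
          exact mul_le_mul_of_nonneg_right hpow hD
      _ ≤ _ := le_add_of_nonneg_right (by positivity)
  · have hpow : (1 / 2 : ℝ) ≤ (2:ℝ) ^ (-C) := by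
      have h := Real.rpow_le_rpow_of_exponent_le (x := 2) one_le_two
        (show (-1 : ℝ) ≤ -C by linarith)
      rw [Real.rpow_neg_one] at h
      linarith
    have htriv : |∑ x, ∑ y₁, ∑ y₂, P x * R (y₁, y₂) * f x y₁ * f x y₂| ≤ 1 := by
      calc |∑ x, ∑ y₁, ∑ y₂, P x * R (y₁, y₂) * f x y₁ * f x y₂|
          ≤ ∑ x, ∑ y₁, ∑ y₂, |P x * R (y₁, y₂) * f x y₁ * f x y₂| := by
            refine (Finset.abs_sum_le_sum_abs _ _).trans (Finset.sum_le_sum fun x _ => ?_)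
            refine (Finset.abs_sum_le_sum_abs _ _).trans (Finset.sum_le_sum fun y₁ _ => ?_)
            exact Finset.abs_sum_le_sum_abs _ _
        _ = ∑ x, P x * ∑ p, R p := by
            simp_rw [abs_mul, hfabs, mul_one, abs_of_nonneg (hP0 _), abs_of_nonneg (hR0 _),
              Fintype.sum_prod_type, Finset.mul_sum]
        _ = 1 := by simp [hR1, hP1]
    have : 0 ≤ (2:ℝ) ^ (3 * k + 2 * C) * disc Θ f := by positivity
    linarith
end

section
/- Fix a real k ≥ 1, integers t_X, t_Y ≥ 2, a finite type Q, a probability distribution Θ on Q, and f : Q × Q → ℝ with values in {−1,1}. Let 𝒟_A be a probability distribution on Q^{t_X} that is k-cbd with respect to Θ, and let 𝒟_B be a probability distribution on Q^{t_Y} that is k-cbd with respect to Θ. Then the variance of the random variable F(x,y) = Σ_{i=1}^{t_X} Σ_{j=1}^{t_Y} f(x_i, y_j), where x ∼ 𝒟_A and y ∼ 𝒟_B independently, satisfies Var[F] ≥ (t_X · t_Y)/3 − 2^{6k} · t_X^{34} · t_Y^{34} · Disc_Θ(f). -/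
/-- A distribution `D` on `Q^t` is `k`-conjunctive block-wise dense (k-cbd) with respect
to `Θ`: some set `J` of at most `t/10` coordinates is fixed to values `α`, and on every
set `S` of coordinates disjoint from `J` the marginal of `D` is at most
`2^(k|S|) ∏_{i∈S} Θ (z i)`. -/
def IsCBD {Q : Type*} [Fintype Q] [DecidableEq Q] (Θ : Q → ℝ) (k : ℝ) {t : ℕ}
    (D : (Fin t → Q) → ℝ) : Prop :=
  ∃ (J : Finset (Fin t)) (α : Fin t → Q),
    (J.card : ℝ) ≤ (t : ℝ) / 10 ∧
    (∀ x, D x ≠ 0 → ∀ i ∈ J, x i = α i) ∧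
    ∀ S : Finset (Fin t), Disjoint S J → ∀ z : Fin t → Q,
      (∑ x ∈ Finset.univ.filter (fun x : Fin t → Q => ∀ i ∈ S, x i = z i), D x)
        ≤ (2:ℝ) ^ (k * S.card) * ∏ i ∈ S, Θ (z i)

section

open Finset

/-- A weighted sum of a function of `π x` is a sum over the values of `π`. -/
theorem sum_mul_comp_eq_sum_fiber {Ω α : Type*} [Fintype Ω] [Fintype α] [DecidableEq α]
    (π : Ω → α) (g : Ω → ℝ) (h : α → ℝ) :
    ∑ x, g x * h (π x) = ∑ a, (∑ x with π x = a, g x) * h a := by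
  rw [← Finset.sum_fiberwise univ π]
  refine Finset.sum_congr rfl fun a _ => ?_
  rw [Finset.sum_mul]
  refine Finset.sum_congr rfl fun x hx => ?_
  rw [(Finset.mem_filter.mp hx).2]

/-- If all subset sums of `Θ * g` are at most `ε`, then weights dominated by `A * Θ` give
sums against `g` of size at most `2 * A * ε`. -/
theorem abs_sum_mul_le_of_subset_sums {Q : Type*} [Fintype Q] {Θ g a : Q → ℝ} {A ε : ℝ}
    (hA : 0 ≤ A) (ha : ∀ z, |a z| ≤ A * Θ z)
    (hg : ∀ S : Finset Q, |∑ z ∈ S, Θ z * g z| ≤ ε) :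
    |∑ z, a z * g z| ≤ 2 * A * ε := by
  classical
  have h1 : |∑ z, a z * g z| ≤ A * ∑ z, Θ z * |g z| := by
    refine (Finset.abs_sum_le_sum_abs _ _).trans ?_
    rw [Finset.mul_sum]
    refine Finset.sum_le_sum fun z _ => ?_
    rw [abs_mul, ← mul_assoc]
    exact mul_le_mul_of_nonneg_right (ha z) (abs_nonneg _)
  have h2 : ∑ z, Θ z * |g z| =
      ∑ z with 0 ≤ g z, Θ z * g z - ∑ z with ¬ 0 ≤ g z, Θ z * g z := by
    rw [← Finset.sum_filter_add_sum_filter_not univ (fun z => 0 ≤ g z), sub_eq_add_neg,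
      ← Finset.sum_neg_distrib]
    congr 1
    · refine Finset.sum_congr rfl fun z hz => ?_
      rw [abs_of_nonneg (Finset.mem_filter.mp hz).2]
    · refine Finset.sum_congr rfl fun z hz => ?_
      rw [abs_of_neg (not_le.mp (Finset.mem_filter.mp hz).2), mul_neg]
  have h3 : ∑ z, Θ z * |g z| ≤ 2 * ε := by
    rw [h2]
    have := (abs_le.mp (hg (univ.filter fun z => 0 ≤ g z))).2
    have := (abs_le.mp (hg (univ.filter fun z => ¬ 0 ≤ g z))).1
    linarith
  nlinarith [mul_le_mul_of_nonneg_left h3 hA]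

/-- A bilinear form that is small on rectangles is small against bounded weights. -/
theorem abs_bilinear_le_of_rectangles {Q : Type*} [Fintype Q] {Θ a b : Q → ℝ}
    {f : Q → Q → ℝ} {A B δ : ℝ}
    (hδ : ∀ S T : Finset Q, |∑ x ∈ S, ∑ y ∈ T, Θ x * Θ y * f x y| ≤ δ)
    (hA : 0 ≤ A) (hB : 0 ≤ B) (ha : ∀ z, |a z| ≤ A * Θ z) (hb : ∀ z, |b z| ≤ B * Θ z) :
    |∑ x, a x * ∑ y, b y * f x y| ≤ 4 * A * B * δ := by
  have h := abs_sum_mul_le_of_subset_sums (g := fun x => ∑ y, b y * f x y) (ε := 2 * B * δ)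
    hA ha fun S => ?_
  · linarith
  · have h' := abs_sum_mul_le_of_subset_sums (g := fun y => ∑ x ∈ S, Θ x * f x y) (ε := δ)
      hB hb fun T => ?_
    · convert h' using 2
      simp_rw [Finset.mul_sum]
      rw [Finset.sum_comm]
      exact Finset.sum_congr rfl fun _ _ => Finset.sum_congr rfl fun _ _ => by ring
    · convert hδ S T using 2
      simp_rw [Finset.mul_sum]
      rw [Finset.sum_comm]
      exact Finset.sum_congr rfl fun _ _ => Finset.sum_congr rfl fun _ _ => by ring

/-- The marginal bounds satisfied by a non-fixed coordinate `i` of a block-wise dense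
distribution: its density is at most `K`, also jointly with any other coordinate. -/
def HasDenseMarginals {Q : Type*} [Fintype Q] [DecidableEq Q] (Θ : Q → ℝ) (K : ℝ) {t : ℕ}
    (D : (Fin t → Q) → ℝ) (i : Fin t) : Prop :=
  (∀ a, ∑ x with x i = a, D x ≤ K * Θ a) ∧
    ∀ i', i' ≠ i → ∃ r : Q → ℝ, (∀ b, 0 ≤ r b) ∧ ∑ b, r b = 1 ∧
      ∀ a b, ∑ x with (x i, x i') = (a, b), D x ≤ K * r b * Θ a

theorem IsCBD.exists_hasDenseMarginals {Q : Type*} [Fintype Q] [DecidableEq Q] {Θ : Q → ℝ}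
    (hΘ0 : ∀ z, 0 ≤ Θ z) (hΘ1 : ∑ z, Θ z = 1) {k : ℝ} (hk : 0 ≤ k) {t : ℕ}
    {D : (Fin t → Q) → ℝ} (hD : ∀ x, 0 ≤ D x) (h : IsCBD Θ k D) :
    ∃ U : Finset (Fin t), 9 / 10 * (t : ℝ) ≤ U.card ∧
      ∀ i ∈ U, HasDenseMarginals Θ ((2 : ℝ) ^ (2 * k)) D i := by
  obtain ⟨J, α, hJ, hfix, hdense⟩ := h
  have hK : (2 : ℝ) ^ k ≤ (2 : ℝ) ^ (2 * k) :=
    Real.rpow_le_rpow_of_exponent_le (by norm_num) (by linarith)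
  refine ⟨Jᶜ, ?_, fun i hi => ?_⟩
  · have : (J.card : ℝ) + (Jᶜ.card : ℝ) = t := by
      exact_mod_cast (by simp : J.card + Jᶜ.card = t)
    linarith
  have hi' : i ∉ J := Finset.mem_compl.mp hi
  have hmarg : ∀ a, ∑ x with x i = a, D x ≤ (2 : ℝ) ^ (2 * k) * Θ a := fun a => by
    have := hdense {i} (by simpa using hi') fun _ => a
    simp only [Finset.mem_singleton, forall_eq, Finset.card_singleton, Nat.cast_one, mul_one,
      Finset.prod_singleton] at this
    exact this.trans (mul_le_mul_of_nonneg_right hK (hΘ0 a))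
  refine ⟨hmarg, fun i' hne => ?_⟩
  by_cases hJ' : i' ∈ J
  · refine ⟨fun b => if b = α i' then 1 else 0, fun b => by positivity, by simp,
      fun a b => ?_⟩
    by_cases hb : b = α i'
    · simp only [hb, if_true, mul_one]
      refine le_trans (Finset.sum_le_sum_of_subset_of_nonneg ?_ fun x _ _ => hD x) (hmarg a)
      intro x hx
      simp only [Finset.mem_filter, Finset.mem_univ, true_and, Prod.mk.injEq] at hx ⊢
      exact hx.1
    · simp only [hb, if_false, mul_zero, zero_mul]
      refine (Finset.sum_eq_zero fun x hx => ?_).le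
      simp only [Finset.mem_filter, Finset.mem_univ, true_and, Prod.mk.injEq] at hx
      by_contra hx0
      exact hb (hx.2 ▸ hfix x hx0 i' hJ')
  · refine ⟨Θ, hΘ0, hΘ1, fun a b => ?_⟩
    have := hdense {i, i'} (by simp [hi', hJ']) fun m => if m = i then a else b
    rw [Finset.card_pair hne.symm, Finset.prod_pair hne.symm] at this
    simp only [Finset.mem_insert, Finset.mem_singleton, forall_eq_or_imp, forall_eq, if_true,
      if_neg hne, Nat.cast_ofNat] at this
    simp only [Prod.mk.injEq]
    rw [mul_comm 2 k]
    linarith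

/-- The correlation of `f (x i) (y j)` with a bounded function of `x` and one further
coordinate of `y` is controlled by the discrepancy. -/
theorem HasDenseMarginals.abs_correlation_le {Q : Type*} [Fintype Q] [DecidableEq Q]
    {Θ : Q → ℝ} {f : Q → Q → ℝ} {δ K : ℝ} (hK : 0 ≤ K)
    (hδ : ∀ S T : Finset Q, |∑ x ∈ S, ∑ y ∈ T, Θ x * Θ y * f x y| ≤ δ)
    {s t : ℕ} {D : (Fin s → Q) → ℝ} {E : (Fin t → Q) → ℝ} (hD : ∀ x, 0 ≤ D x)
    (hE : ∀ y, 0 ≤ E y) {i : Fin s} {j j' : Fin t} (hi : HasDenseMarginals Θ K D i)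
    (hj : HasDenseMarginals Θ K E j) (hne : j' ≠ j) (W : (Fin s → Q) → Q → ℝ)
    (hW : ∀ x b, |W x b| ≤ 1) :
    |∑ x, ∑ y, D x * E y * (f (x i) (y j) * W x (y j'))| ≤ 4 * K ^ 2 * δ := by
  obtain ⟨r, hr0, hr1, hr⟩ := hj.2 j' hne
  set u : Q → Q → ℝ := fun b' a => ∑ x with x i = a, D x * W x b' with hu
  set R : Q → Q → ℝ := fun b' b => ∑ y with (y j, y j') = (b, b'), E y with hR
  have hub : ∀ b' a, |u b' a| ≤ K * Θ a := fun b' a => by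
    refine (Finset.abs_sum_le_sum_abs _ _).trans (le_trans (Finset.sum_le_sum fun x _ => ?_)
      (hi.1 a))
    rw [abs_mul, abs_of_nonneg (hD x)]
    exact mul_le_of_le_one_right (hD x) (hW x b')
  have hRb : ∀ b' b, |R b' b| ≤ K * r b' * Θ b := fun b' b => by
    rw [abs_of_nonneg (Finset.sum_nonneg fun y _ => hE y)]
    exact hr b b'
  have key : ∑ x, ∑ y, D x * E y * (f (x i) (y j) * W x (y j')) =
      ∑ b', ∑ a, u b' a * ∑ b, R b' b * f a b := by
    have h1 : ∀ b b', ∑ x, D x * W x b' * f (x i) b = ∑ a, u b' a * f a b := fun b b' =>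
      sum_mul_comp_eq_sum_fiber (fun x : Fin s → Q => x i) (fun x => D x * W x b')
        fun a => f a b
    have h2 := sum_mul_comp_eq_sum_fiber (fun y : Fin t → Q => (y j, y j')) E
      fun p => ∑ x, D x * W x p.2 * f (x i) p.1
    rw [Finset.sum_comm]
    calc _ = ∑ y, E y * ∑ x, D x * W x (y j') * f (x i) (y j) := by
          simp_rw [Finset.mul_sum]
          exact Finset.sum_congr rfl fun _ _ => Finset.sum_congr rfl fun _ _ => by ring
      _ = _ := by
          rw [h2, Fintype.sum_prod_type, Finset.sum_comm]
          refine Finset.sum_congr rfl fun b' _ => ?_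
          simp_rw [h1, Finset.mul_sum]
          rw [Finset.sum_comm]
          exact Finset.sum_congr rfl fun _ _ => Finset.sum_congr rfl fun _ _ => by
            simp only [hR]; ring
  rw [key]
  calc _ ≤ ∑ b', |∑ a, u b' a * ∑ b, R b' b * f a b| := Finset.abs_sum_le_sum_abs _ _
    _ ≤ ∑ b', 4 * K * (K * r b') * δ := Finset.sum_le_sum fun b' _ =>
        abs_bilinear_le_of_rectangles hδ hK (mul_nonneg hK (hr0 b')) (hub b') (hRb b')
    _ = ∑ b', 4 * K ^ 2 * δ * r b' := Finset.sum_congr rfl fun _ _ => by ring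
    _ = 4 * K ^ 2 * δ := by rw [← Finset.mul_sum, hr1, mul_one]

/-- The second moment of `∑ p, φ p` exceeds the square of its mean by almost `#T` if the
signs `φ p` with `p ∈ T` are almost centred and almost uncorrelated with all others. -/
theorem card_sub_le_variance_sum_signs {Ω ι : Type*} [Fintype Ω] [Fintype ι]
    {w : Ω → ℝ} (hw0 : ∀ ω, 0 ≤ w ω) (hw1 : ∑ ω, w ω = 1) {φ : ι → Ω → ℝ}
    (hφ : ∀ p ω, φ p ω = 1 ∨ φ p ω = -1) (T : Finset ι) {c : ℝ} (hc : 0 ≤ c)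
    (hmean : ∀ p ∈ T, |∑ ω, w ω * φ p ω| ≤ c)
    (hcorr : ∀ p ∈ T, ∀ q, q ≠ p → |∑ ω, w ω * (φ p ω * φ q ω)| ≤ c) :
    (T.card : ℝ) - 5 * (Fintype.card ι : ℝ) ^ 2 * c ≤
      ∑ ω, w ω * (∑ p, φ p ω) ^ 2 - (∑ ω, w ω * ∑ p, φ p ω) ^ 2 := by
  classical
  set N : ℝ := (Fintype.card ι : ℝ)
  set n : ℝ := (T.card : ℝ)
  have hnN : n ≤ N := Nat.cast_le.mpr (Finset.card_le_univ T)
  have hn0 : 0 ≤ n := Nat.cast_nonneg _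
  set F : Ω → ℝ := fun ω => ∑ p, φ p ω
  set M : Ω → ℝ := fun ω => ∑ p ∈ T, φ p ω
  set EF := ∑ ω, w ω * F ω with hEF
  set EM := ∑ ω, w ω * M ω with hEM
  have hdiag : ∀ p, ∑ ω, w ω * (φ p ω * φ p ω) = 1 := fun p => by
    rw [← hw1]
    refine Finset.sum_congr rfl fun ω _ => ?_
    rcases hφ p ω with h | h <;> rw [h] <;> ring
  have hrow : ∀ S : Finset ι, ∀ p ∈ T, p ∈ S →
      |(∑ q ∈ S, ∑ ω, w ω * (φ p ω * φ q ω)) - 1| ≤ N * c := fun S p hp hpS => by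
    rw [← Finset.add_sum_erase S _ hpS, hdiag, add_sub_cancel_left]
    refine (Finset.abs_sum_le_sum_abs _ _).trans ?_
    refine (Finset.sum_le_card_nsmul _ _ c fun q hq =>
      hcorr p hp q (Finset.ne_of_mem_erase hq)).trans ?_
    rw [nsmul_eq_mul]
    exact mul_le_mul_of_nonneg_right (Nat.cast_le.mpr (Finset.card_le_univ _)) hc
  have hexp : ∀ S : Finset ι, T ⊆ S →
      |∑ ω, w ω * (M ω * ∑ q ∈ S, φ q ω) - n| ≤ N * N * c := fun S hTS => by
    have : ∑ ω, w ω * (M ω * ∑ q ∈ S, φ q ω) - n =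
        ∑ p ∈ T, ((∑ q ∈ S, ∑ ω, w ω * (φ p ω * φ q ω)) - 1) := by
      rw [Finset.sum_sub_distrib, Finset.sum_const, nsmul_eq_mul, mul_one]
      congr 1
      simp_rw [M, Finset.sum_mul_sum, Finset.mul_sum]
      rw [Finset.sum_comm]
      exact Finset.sum_congr rfl fun _ _ => Finset.sum_comm
    rw [this]
    refine (Finset.abs_sum_le_sum_abs _ _).trans ?_
    refine (Finset.sum_le_card_nsmul _ _ (N * c) fun p hp => hrow S p hp (hTS hp)).trans ?_
    rw [nsmul_eq_mul, mul_assoc]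
    exact mul_le_mul_of_nonneg_right hnN (mul_nonneg (hn0.trans hnN) hc)
  have hMF : |∑ ω, w ω * (M ω * F ω) - n| ≤ N * N * c := hexp univ (Finset.subset_univ T)
  have hMM : |∑ ω, w ω * (M ω * M ω) - n| ≤ N * N * c := hexp T subset_rfl
  have hEMb : |EM| ≤ N * c := by
    have : EM = ∑ p ∈ T, ∑ ω, w ω * φ p ω := by
      simp_rw [hEM, M, Finset.mul_sum]
      exact Finset.sum_comm
    rw [this]
    refine (Finset.abs_sum_le_sum_abs _ _).trans ?_
    refine (Finset.sum_le_card_nsmul _ _ c hmean).trans ?_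
    rw [nsmul_eq_mul]
    exact mul_le_mul_of_nonneg_right hnN hc
  have hEFb : |EF| ≤ N := by
    refine (Finset.abs_sum_le_sum_abs _ _).trans ?_
    have : ∀ ω, |w ω * F ω| ≤ w ω * N := fun ω => by
      rw [abs_mul, abs_of_nonneg (hw0 ω)]
      refine mul_le_mul_of_nonneg_left ((Finset.abs_sum_le_sum_abs _ _).trans ?_) (hw0 ω)
      refine (Finset.sum_le_card_nsmul _ _ 1 fun p _ => ?_).trans (by simp [N])
      rcases hφ p ω with h | h <;> simp [h]
    refine (Finset.sum_le_sum fun ω _ => this ω).trans ?_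
    rw [← Finset.sum_mul, hw1, one_mul]
  have hprod : EF * EM ≤ N * N * c := by
    refine (le_abs_self _).trans ?_
    rw [abs_mul, mul_assoc]
    exact mul_le_mul hEFb hEMb (abs_nonneg _) (hn0.trans hnN)
  have hvar : 0 ≤ ∑ ω, w ω * ((F ω - M ω) - (EF - EM)) ^ 2 :=
    Finset.sum_nonneg fun ω _ => mul_nonneg (hw0 ω) (sq_nonneg _)
  have hvar' : ∑ ω, w ω * ((F ω - M ω) - (EF - EM)) ^ 2 =
      ∑ ω, w ω * F ω ^ 2 - 2 * ∑ ω, w ω * (M ω * F ω) + ∑ ω, w ω * (M ω * M ω)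
        - 2 * (EF - EM) * (EF - EM) + (EF - EM) ^ 2 := by
    generalize hd : EF - EM = d
    have hd1 : ∑ ω, w ω * d ^ 2 = d ^ 2 := by rw [← Finset.sum_mul, hw1, one_mul]
    have hd2 : ∑ ω, 2 * d * (w ω * F ω - w ω * M ω) = 2 * d * d := by
      rw [← Finset.mul_sum, Finset.sum_sub_distrib, ← hEF, ← hEM, hd]
    rw [← hd2, ← hd1, Finset.mul_sum, ← Finset.sum_sub_distrib, ← Finset.sum_add_distrib,
      ← Finset.sum_sub_distrib, ← Finset.sum_add_distrib]
    exact Finset.sum_congr rfl fun _ _ => by ring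
  have h1 := (abs_le.mp hMF).1
  have h2 := (abs_le.mp hMM).2
  nlinarith [sq_nonneg EM]

end

theorem stmt_16 {Q : Type*} [Fintype Q] [DecidableEq Q]
    (Θ : Q → ℝ) (hΘ0 : ∀ z, 0 ≤ Θ z) (hΘ1 : ∑ z, Θ z = 1)
    (f : Q → Q → ℝ) (hf : ∀ x y, f x y = 1 ∨ f x y = -1)
    (k : ℝ) (hk : 1 ≤ k)
    (tX tY : ℕ) (htX : 2 ≤ tX) (htY : 2 ≤ tY)
    (DA : (Fin tX → Q) → ℝ) (hDA0 : ∀ x, 0 ≤ DA x) (hDA1 : ∑ x, DA x = 1)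
    (DB : (Fin tY → Q) → ℝ) (hDB0 : ∀ y, 0 ≤ DB y) (hDB1 : ∑ y, DB y = 1)
    (hcbdA : IsCBD Θ k DA) (hcbdB : IsCBD Θ k DB)
    (F : (Fin tX → Q) → (Fin tY → Q) → ℝ)
    (hF : ∀ x y, F x y = ∑ i, ∑ j, f (x i) (y j)) :
    (tX : ℝ) * tY / 3 - (2:ℝ) ^ (6 * k) * (tX : ℝ) ^ 34 * (tY : ℝ) ^ 34 * disc Θ f
      ≤ (∑ x, ∑ y, DA x * DB y * F x y ^ 2)
          - (∑ x, ∑ y, DA x * DB y * F x y) ^ 2 := by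
  have hk0 : 0 ≤ k := by linarith
  obtain ⟨U, hU, hUd⟩ := IsCBD.exists_hasDenseMarginals hΘ0 hΘ1 hk0 hDA0 hcbdA
  obtain ⟨V, hV, hVd⟩ := IsCBD.exists_hasDenseMarginals hΘ0 hΘ1 hk0 hDB0 hcbdB
  set K : ℝ := (2 : ℝ) ^ (2 * k)
  set δ := disc Θ f
  have hK : 0 ≤ K := Real.rpow_nonneg (by norm_num) _
  have hδ : ∀ S T : Finset Q, |∑ x ∈ S, ∑ y ∈ T, Θ x * Θ y * f x y| ≤ δ := fun S T =>
    Finset.le_sup' (fun AB : Finset Q × Finset Q =>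
      |∑ x ∈ AB.1, ∑ y ∈ AB.2, Θ x * Θ y * f x y|) (Finset.mem_univ (S, T))
  have hδ' : ∀ S T : Finset Q, |∑ x ∈ S, ∑ y ∈ T, Θ x * Θ y * f y x| ≤ δ := fun S T => by
    convert hδ T S using 2
    rw [Finset.sum_comm]
    exact Finset.sum_congr rfl fun _ _ => Finset.sum_congr rfl fun _ _ => by ring
  have hδ0 : 0 ≤ δ := (abs_nonneg _).trans (hδ ∅ ∅)
  have hfabs : ∀ x y, |f x y| ≤ 1 := fun x y => by rcases hf x y with h | h <;> simp [h]
  have hmean : ∀ p ∈ U ×ˢ V, |∑ ω : (Fin tX → Q) × (Fin tY → Q),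
      DA ω.1 * DB ω.2 * f (ω.1 p.1) (ω.2 p.2)| ≤ 4 * K ^ 2 * δ := fun p hp => by
    rw [Finset.mem_product] at hp
    have : Nontrivial (Fin tY) := Fin.nontrivial_iff_two_le.mpr htY
    obtain ⟨j', hj'⟩ := exists_ne p.2
    have := HasDenseMarginals.abs_correlation_le hK hδ hDA0 hDB0 (hUd _ hp.1)
      (hVd _ hp.2) hj' (fun _ _ => 1) (by simp)
    rw [Fintype.sum_prod_type]
    simpa only [mul_one] using this
  have hcorr : ∀ p ∈ U ×ˢ V, ∀ q, q ≠ p → |∑ ω : (Fin tX → Q) × (Fin tY → Q),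
      DA ω.1 * DB ω.2 * (f (ω.1 p.1) (ω.2 p.2) * f (ω.1 q.1) (ω.2 q.2))| ≤
        4 * K ^ 2 * δ := fun p hp q hq => by
    rw [Finset.mem_product] at hp
    rw [Fintype.sum_prod_type]
    by_cases h2 : q.2 = p.2
    · have h1 : q.1 ≠ p.1 := fun h1 => hq (Prod.ext h1 h2)
      have := HasDenseMarginals.abs_correlation_le hK hδ' hDB0 hDA0 (hVd _ hp.2)
        (hUd _ hp.1) h1 (fun y a => f a (y q.2)) (fun _ _ => hfabs _ _)
      rw [Finset.sum_comm]
      simpa only [mul_comm (DA _) (DB _)] using this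
    · exact HasDenseMarginals.abs_correlation_le hK hδ hDA0 hDB0 (hUd _ hp.1)
        (hVd _ hp.2) h2 (fun x b => f (x q.1) b) (fun _ _ => hfabs _ _)
  have hw1 : ∑ ω : (Fin tX → Q) × (Fin tY → Q), DA ω.1 * DB ω.2 = 1 := by
    rw [Fintype.sum_prod_type, ← Finset.sum_mul_sum, hDA1, hDB1, mul_one]
  have hmain := card_sub_le_variance_sum_signs
    (φ := fun p (ω : (Fin tX → Q) × (Fin tY → Q)) => f (ω.1 p.1) (ω.2 p.2))
    (fun ω => mul_nonneg (hDA0 ω.1) (hDB0 ω.2)) hw1 (fun _ _ => hf _ _) (U ×ˢ V)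
    (by positivity) hmean hcorr
  simp only [Fintype.sum_prod_type, ← hF, Finset.card_product, Fintype.card_prod,
    Fintype.card_fin, Nat.cast_mul] at hmain
  refine le_trans ?_ hmain
  have htX' : (2 : ℝ) ≤ tX := by exact_mod_cast htX
  have htY' : (2 : ℝ) ≤ tY := by exact_mod_cast htY
  have hcard : (tX : ℝ) * tY / 3 ≤ (U.card : ℝ) * V.card := by
    have := mul_le_mul hU hV (by positivity) (by positivity)
    nlinarith [mul_pos (show (0 : ℝ) < tX by linarith) (show (0 : ℝ) < tY by linarith)]
  have hK6 : K ^ 2 ≤ (2 : ℝ) ^ (6 * k) := by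
    rw [← Real.rpow_natCast, ← Real.rpow_mul (by norm_num)]
    exact Real.rpow_le_rpow_of_exponent_le (by norm_num) (by push_cast; linarith)
  have hpow : 20 * ((tX : ℝ) * tY) ^ 2 ≤ (tX : ℝ) ^ 34 * (tY : ℝ) ^ 34 := by
    have h20 : (20 : ℝ) ≤ ((tX : ℝ) * tY) ^ 32 := by
      calc (20 : ℝ) ≤ 4 ^ 32 := by norm_num
        _ ≤ _ := pow_le_pow_left₀ (by norm_num) (by nlinarith) _
    calc 20 * ((tX : ℝ) * tY) ^ 2 ≤ ((tX : ℝ) * tY) ^ 32 * ((tX : ℝ) * tY) ^ 2 :=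
          mul_le_mul_of_nonneg_right h20 (sq_nonneg _)
      _ = _ := by ring
  have herr : 5 * ((tX : ℝ) * tY) ^ 2 * (4 * K ^ 2 * δ) ≤
      (2 : ℝ) ^ (6 * k) * (tX : ℝ) ^ 34 * (tY : ℝ) ^ 34 * δ := by
    have := mul_le_mul_of_nonneg_right
      (mul_le_mul hK6 hpow (by positivity) (by positivity)) hδ0
    linarith
  linarith
end

section
/- Let Q be a finite type, Θ a probability distribution on Q, t ≥ 1 an integer, and k > 0 a real number with k·t ≥ 7. Let 𝒟 be a probability distribution on Q^t satisfying 𝒟(x) ≤ 2^{kt} · Π_{i=1}^t Θ(x_i) for all x ∈ Q^t. Then there exists a finite collection of pairwise disjoint sets S_1, …, S_N, S_err whose union is Q^t such that 𝒟(S_i) > 0 and the conditional distribution of 𝒟 on each S_i (i = 1,…,N) is 20k-cbd with respect to Θ, and 𝒟(S_err) ≤ 1/100. -/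
/-- Greedy exhaustion: if every set of mass more than `ε` contains a nonempty good subset, then any
set splits into finitely many disjoint good sets and a remainder of mass at most `ε`. -/
lemma exists_disjoint_family_of_exhaustion {X : Type*} [DecidableEq X] (D : X → ℝ) (ε : ℝ)
    (P : Finset X → Prop)
    (h : ∀ R : Finset X, ε < ∑ x ∈ R, D x → ∃ A ⊆ R, A.Nonempty ∧ P A) (R : Finset X) :
    ∃ (N : ℕ) (S : Fin N → Finset X) (E : Finset X),
      (∀ i j, i ≠ j → Disjoint (S i) (S j)) ∧ (∀ i, Disjoint (S i) E) ∧
      Finset.univ.biUnion S ∪ E = R ∧ (∀ i, P (S i)) ∧ ∑ x ∈ E, D x ≤ ε := by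
  induction R using Finset.strongInduction with
  | H R ih =>
    by_cases hR : ε < ∑ x ∈ R, D x
    · obtain ⟨A, hAR, hA, hP⟩ := h R hR
      obtain ⟨N, S, E, hS, hSE, hU, hPS, hE⟩ := ih (R \ A) (Finset.sdiff_ssubset hAR hA)
      have hSA : ∀ i, Disjoint A (S i) := fun i =>
        Finset.disjoint_sdiff.mono_right <| hU ▸
          (Finset.subset_biUnion_of_mem S (Finset.mem_univ i)).trans Finset.subset_union_left
      have hEA : Disjoint A E :=
        Finset.disjoint_sdiff.mono_right (hU ▸ Finset.subset_union_right)
      refine ⟨N + 1, Fin.cons A S, E, ?_, ?_, ?_, ?_, hE⟩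
      · intro i j hij
        induction i using Fin.cases with
        | zero =>
          induction j using Fin.cases with
          | zero => exact absurd rfl hij
          | succ j => simpa using hSA j
        | succ i =>
          induction j using Fin.cases with
          | zero => simpa using (hSA i).symm
          | succ j => simpa using hS i j fun hij' => hij (congrArg Fin.succ hij')
      · intro i
        induction i using Fin.cases with
        | zero => simpa using hEA
        | succ i => simpa using hSE i
      · rw [← Finset.union_sdiff_of_subset hAR, ← hU, ← Finset.union_assoc]
        congr 1
        ext x
        simp [Fin.exists_fin_succ]
      · intro i
        induction i using Fin.cases with
        | zero => simpa using hP
        | succ i => simpa using hPS i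
    · exact ⟨0, Fin.elim0, R, fun i => i.elim0, fun i => i.elim0, by simp, fun i => i.elim0,
        not_lt.mp hR⟩

/-- The product distribution gives the cylinder `{x | ∀ i ∈ I, x i = z i}` the mass
`∏ i ∈ I, Θ (z i)`. -/
lemma sum_cylinder_prod {ι Q : Type*} [Fintype ι] [DecidableEq ι] [Fintype Q] [DecidableEq Q]
    (Θ : Q → ℝ) (hΘ1 : ∑ z, Θ z = 1) (I : Finset ι) (z : ι → Q)
    [DecidablePred fun x : ι → Q => ∀ i ∈ I, x i = z i] :
    ∑ x ∈ Finset.univ.filter (fun x : ι → Q => ∀ i ∈ I, x i = z i), ∏ i, Θ (x i)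
      = ∏ i ∈ I, Θ (z i) := by
  have hset : Finset.univ.filter (fun x : ι → Q => ∀ i ∈ I, x i = z i)
      = Fintype.piFinset (fun i => if i ∈ I then {z i} else Finset.univ) := by
    ext x
    simp only [Finset.mem_filter, Finset.mem_univ, true_and, Fintype.mem_piFinset]
    refine forall_congr' fun i => ?_
    by_cases hi : i ∈ I <;> simp [hi]
  rw [hset, ← Finset.prod_univ_sum (fun i => if i ∈ I then {z i} else Finset.univ)
    (fun _ q => Θ q), ← Finset.prod_subset (Finset.subset_univ I)]
  · exact Finset.prod_congr rfl fun i hi => by simp [hi]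
  · intro i _ hi
    simp [hi, hΘ1]

/-- Conditioning on a maximal set of coordinates whose density is too high restores density: every
set `R` of mass more than `1 / 100` contains a cylinder, relative to `R`, on which the conditional
distribution is conjunctive block-wise dense. -/
lemma exists_isCBD_subset {Q : Type*} [Fintype Q] [DecidableEq Q]
    (Θ : Q → ℝ) (hΘ0 : ∀ z, 0 ≤ Θ z) (hΘ1 : ∑ z, Θ z = 1)
    (t : ℕ) (k : ℝ) (hk : 0 < k) (hkt : 7 ≤ k * t)
    (D : (Fin t → Q) → ℝ) (hD0 : ∀ x, 0 ≤ D x)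
    (hDd : ∀ x, D x ≤ (2:ℝ) ^ (k * t) * ∏ i, Θ (x i))
    (R : Finset (Fin t → Q)) (hR : 1 / 100 < ∑ x ∈ R, D x) :
    ∃ A ⊆ R, 0 < ∑ x ∈ A, D x ∧
      IsCBD Θ (20 * k) (fun x => if x ∈ A then D x / ∑ x' ∈ A, D x' else 0) := by
  have hR0 : 0 < ∑ x ∈ R, D x := by linarith
  let m : Finset (Fin t) → (Fin t → Q) → ℝ := fun I z =>
    ∑ x ∈ R.filter (fun x => ∀ i ∈ I, x i = z i), D x
  let Dense : Finset (Fin t) → Prop := fun I => ∃ z, 0 < m I z ∧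
    (∑ x ∈ R, D x) * ((2:ℝ) ^ (20 * k * I.card) * ∏ i ∈ I, Θ (z i)) ≤ m I z
  have hne : Dense ∅ := by
    obtain ⟨z, -⟩ := Finset.nonempty_of_sum_ne_zero hR0.ne'
    exact ⟨z, by simpa [m] using hR0, by simp [m]⟩
  obtain ⟨I, hI⟩ := (Set.toFinite {I | Dense I}).exists_maximal ⟨∅, hne⟩
  obtain ⟨z, hz0, hz⟩ := hI.prop
  refine ⟨R.filter (fun x => ∀ i ∈ I, x i = z i), Finset.filter_subset _ _, hz0, I, z, ?_, ?_, ?_⟩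
  · have hup : m I z ≤ (2:ℝ) ^ (k * t) * ∏ i ∈ I, Θ (z i) := by
      rw [← sum_cylinder_prod Θ hΘ1 I z, Finset.mul_sum]
      exact (Finset.sum_le_sum_of_subset_of_nonneg
        (Finset.filter_subset_filter _ (Finset.subset_univ R)) fun x _ _ => hD0 x).trans
        (Finset.sum_le_sum fun x _ => hDd x)
    have hpos : 0 < ∏ i ∈ I, Θ (z i) :=
      pos_of_mul_pos_right (hz0.trans_le hup) (by positivity)
    have hlt : (2:ℝ) ^ (20 * k * I.card) < 2 ^ (7 + k * t : ℝ) := by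
      have h7 : (2:ℝ) ^ (7 + k * t : ℝ) = 128 * 2 ^ (k * t) := by
        rw [Real.rpow_add two_pos]
        norm_num
      have hpow : (0:ℝ) < 2 ^ (20 * k * I.card) := by positivity
      have hle : (∑ x ∈ R, D x) * (2:ℝ) ^ (20 * k * I.card) ≤ 2 ^ (k * t) :=
        le_of_mul_le_mul_right (by rw [mul_assoc]; exact hz.trans hup) hpos
      rw [h7]
      nlinarith
    have hexp := (Real.rpow_lt_rpow_left_iff one_lt_two).mp hlt
    have : k * (20 * I.card) ≤ k * (2 * t) := by linarith
    linarith [le_of_mul_le_mul_left this hk]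
  · intro x hx i hi
    by_contra hxi
    refine hx (if_neg fun hmem => hxi ?_)
    exact (Finset.mem_filter.mp hmem).2 i hi
  · intro S hSI y
    rw [← Finset.sum_filter, ← Finset.sum_div, div_le_iff₀ hz0]
    obtain rfl | hS := S.eq_empty_or_nonempty
    · simpa using (Finset.sum_congr (by ext x; simp) fun _ _ => rfl).le
    have hprod : ∏ i ∈ I ∪ S, Θ (I.piecewise z y i)
        = (∏ i ∈ I, Θ (z i)) * ∏ i ∈ S, Θ (y i) := by
      rw [Finset.prod_union hSI.symm]
      congr 1
      · exact Finset.prod_congr rfl fun i hi => by rw [Finset.piecewise_eq_of_mem _ _ _ hi]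
      · exact Finset.prod_congr rfl fun i hi => by
          rw [Finset.piecewise_eq_of_notMem _ _ _ (Finset.disjoint_left.mp hSI hi)]
    have hset : (Finset.univ.filter (fun x : Fin t → Q => ∀ i ∈ S, x i = y i)).filter
          (fun x => x ∈ R.filter (fun x => ∀ i ∈ I, x i = z i))
        = R.filter (fun x => ∀ i ∈ I ∪ S, x i = I.piecewise z y i) := by
      ext x
      have hpw : (∀ i ∈ I ∪ S, x i = I.piecewise z y i) ↔
          (∀ i ∈ I, x i = z i) ∧ ∀ i ∈ S, x i = y i := by
        rw [Finset.forall_mem_union]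
        refine and_congr (forall₂_congr fun i hi => ?_) (forall₂_congr fun i hi => ?_)
        · rw [Finset.piecewise_eq_of_mem _ _ _ hi]
        · rw [Finset.piecewise_eq_of_notMem _ _ _ (Finset.disjoint_left.mp hSI hi)]
      simp only [Finset.mem_filter, Finset.mem_univ, true_and, hpw]
      tauto
    rw [hset]
    change m (I ∪ S) (I.piecewise z y) ≤ _ * m I z
    have hSΘ : 0 ≤ (2:ℝ) ^ (20 * k * S.card) * ∏ i ∈ S, Θ (y i) :=
      mul_nonneg (by positivity) (Finset.prod_nonneg fun i _ => hΘ0 _)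
    by_cases hm : 0 < m (I ∪ S) (I.piecewise z y)
    · have hnot : ¬ Dense (I ∪ S) := fun hd => by
        obtain ⟨i, hi⟩ := hS
        exact Finset.disjoint_left.mp hSI hi
          (hI.le_of_ge hd Finset.subset_union_left (Finset.mem_union_right I hi))
      have hlt := not_le.mp fun hle => hnot ⟨_, hm, hle⟩
      rw [hprod, Finset.card_union_of_disjoint hSI.symm, Nat.cast_add, mul_add,
        Real.rpow_add two_pos] at hlt
      linarith [mul_le_mul_of_nonneg_left hz hSΘ]
    · exact (not_lt.mp hm).trans (mul_nonneg hSΘ hz0.le)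

theorem stmt_17 {Q : Type*} [Fintype Q] [DecidableEq Q]
    (Θ : Q → ℝ) (hΘ0 : ∀ z, 0 ≤ Θ z) (hΘ1 : ∑ z, Θ z = 1)
    (t : ℕ) (ht : 1 ≤ t) (k : ℝ) (hk : 0 < k) (hkt : 7 ≤ k * t)
    (D : (Fin t → Q) → ℝ) (hD0 : ∀ x, 0 ≤ D x) (hD1 : ∑ x, D x = 1)
    (hDd : ∀ x, D x ≤ (2:ℝ) ^ (k * t) * ∏ i, Θ (x i)) :
    ∃ (N : ℕ) (S : Fin N → Finset (Fin t → Q)) (Serr : Finset (Fin t → Q)),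
      (∀ i j, i ≠ j → Disjoint (S i) (S j)) ∧
      (∀ i, Disjoint (S i) Serr) ∧
      (Finset.univ.biUnion S ∪ Serr = Finset.univ) ∧
      (∀ i, 0 < ∑ x ∈ S i, D x) ∧
      (∀ i, IsCBD Θ (20 * k)
        (fun x => if x ∈ S i then D x / ∑ x' ∈ S i, D x' else 0)) ∧
      ∑ x ∈ Serr, D x ≤ 1 / 100 := by
  have hD : ∀ R : Finset (Fin t → Q), 1 / 100 < ∑ x ∈ R, D x → ∃ A ⊆ R, A.Nonempty ∧
      (0 < ∑ x ∈ A, D x ∧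
        IsCBD Θ (20 * k) (fun x => if x ∈ A then D x / ∑ x' ∈ A, D x' else 0)) := by
    intro R hR
    obtain ⟨A, hAR, hA, hcbd⟩ := exists_isCBD_subset Θ hΘ0 hΘ1 t k hk hkt D hD0 hDd R hR
    exact ⟨A, hAR, Finset.nonempty_of_sum_ne_zero hA.ne', hA, hcbd⟩
  obtain ⟨N, S, E, hS, hSE, hU, hP, hE⟩ :=
    exists_disjoint_family_of_exhaustion D (1 / 100) _ hD Finset.univ
  exact ⟨N, S, E, hS, hSE, hU, fun i => (hP i).1, fun i => (hP i).2, hE⟩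
end

section
/- Let n, N ≥ 1 be integers and ε ∈ ℝ. Consider the uniform probability distribution over pairs (a, y), where a = (a_1,…,a_N) ∈ ((𝔽₂)^n)^N and y = (y_1,…,y_N) ∈ {−1,1}^N. For such a pair define err₀(a,y) = 2^{−n} · Σ_{x ∈ (𝔽₂)^n} Π_{i=1}^N (1 + ε · y_i · (−1)^{⟨a_i, x⟩}) − 1, where ⟨a_i, x⟩ = Σ_{j=1}^n a_{i,j} x_j computed in 𝔽₂ and (−1)^b equals 1 if b = 0 and −1 if b = 1. Then E_{a,y}[ err₀(a,y)² ] = ((1 + ε²)^N − 1) · 2^{−n}. -/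
theorem Fintype.sum_pi_prod_eq_prod_sum {ι κ R : Type*} [Fintype ι] [DecidableEq ι] [Fintype κ]
    [CommSemiring R] (f : ι → κ → R) :
    ∑ v : ι → κ, ∏ i, f i (v i) = ∏ i, ∑ k, f i k := by
  rw [Finset.prod_univ_sum, Fintype.piFinset_univ]

theorem sum_sum_prod_eq_pow {κ μ R : Type*} [Fintype κ] [Fintype μ] [CommSemiring R] (N : ℕ)
    (f : κ → μ → R) :
    ∑ a : Fin N → κ, ∑ y : Fin N → μ, ∏ i, f (a i) (y i) = (∑ k, ∑ m, f k m) ^ N := by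
  simp_rw [fun a : Fin N → κ => Fintype.sum_pi_prod_eq_prod_sum fun i m => f (a i) m]
  rw [Fintype.sum_pi_prod_eq_prod_sum fun _ k => ∑ m, f k m]
  simp

theorem sum_int_units {R : Type*} [AddCommMonoid R] (f : ℤˣ → R) :
    ∑ u, f u = f 1 + f (-1) := by
  rw [show (Finset.univ : Finset ℤˣ) = {1, -1} from by decide, Finset.sum_pair (by decide)]

theorem sum_sum_sum_rotate {α β γ R : Type*} [Fintype α] [Fintype β] [Fintype γ]
    [AddCommMonoid R] (f : α → β → γ → R) :
    ∑ a, ∑ b, ∑ c, f a b c = ∑ c, ∑ a, ∑ b, f a b c := by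
  rw [Finset.sum_comm (s := (Finset.univ : Finset γ))]
  exact Finset.sum_congr rfl fun a _ => Finset.sum_comm

theorem zmod_two_eq_zero_or_one : ∀ a : ZMod 2, a = 0 ∨ a = 1 := by
  decide

theorem sum_sum_prod_one_add (n N : ℕ) (ε : ℝ) (χ : ZMod 2 → ℝ)
    (x : Fin n → ZMod 2) :
    ∑ a : Fin N → Fin n → ZMod 2, ∑ y : Fin N → ℤˣ,
      ∏ i, (1 + ε * ((y i : ℤ) : ℝ) * χ (∑ j, a i j * x j)) = (2 ^ n * 2) ^ N := by
  rw [sum_sum_prod_eq_pow N fun (v : Fin n → ZMod 2) (u : ℤˣ) =>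
    1 + ε * ((u : ℤ) : ℝ) * χ (∑ j, v j * x j)]
  congr 1
  simp_rw [sum_int_units]
  trans ∑ v : Fin n → ZMod 2, (2 : ℝ)
  · refine Finset.sum_congr rfl fun v _ => ?_
    push_cast
    ring
  · simp

theorem sign_sum_eq_prod {χ : ZMod 2 → ℝ}
    (hχ : ∀ b, χ b = if b = 0 then 1 else -1) {ι : Type*} (s : Finset ι) (f : ι → ZMod 2) :
    χ (∑ i ∈ s, f i) = ∏ i ∈ s, χ (f i) := by
  classical
  have hadd : ∀ a b, χ (a + b) = χ a * χ b := by
    intro a b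
    simp only [hχ]
    rcases zmod_two_eq_zero_or_one a with rfl | rfl <;>
      rcases zmod_two_eq_zero_or_one b with rfl | rfl <;> simp [CharTwo.add_self_eq_zero]
  induction s using Finset.induction_on with
  | empty => simp [hχ]
  | insert i s hi ih => rw [Finset.sum_insert hi, Finset.prod_insert hi, hadd, ih]

theorem sum_sign_dot_mul_sign_dot {χ : ZMod 2 → ℝ}
    (hχ : ∀ b, χ b = if b = 0 then 1 else -1) {n : ℕ} (x z : Fin n → ZMod 2) :
    ∑ v : Fin n → ZMod 2, χ (∑ j, v j * x j) * χ (∑ j, v j * z j)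
      = if x = z then (2 : ℝ) ^ n else 0 := by
  have hone : ∀ a b : ZMod 2, ∑ c, χ (c * a) * χ (c * b) = if a = b then (2 : ℝ) else 0 := by
    intro a b
    rw [show (Finset.univ : Finset (ZMod 2)) = {0, 1} from rfl, Finset.sum_pair (by decide)]
    simp only [hχ]
    rcases zmod_two_eq_zero_or_one a with rfl | rfl <;>
      rcases zmod_two_eq_zero_or_one b with rfl | rfl <;> norm_num
  simp_rw [sign_sum_eq_prod hχ, ← Finset.prod_mul_distrib]
  rw [Fintype.sum_pi_prod_eq_prod_sum fun j c => χ (c * x j) * χ (c * z j)]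
  simp_rw [hone]
  split_ifs with h
  · simp [h]
  · obtain ⟨j, hj⟩ := Function.ne_iff.mp h
    exact Finset.prod_eq_zero (Finset.mem_univ j) (if_neg hj)

theorem sum_sum_prod_one_add_mul {χ : ZMod 2 → ℝ}
    (hχ : ∀ b, χ b = if b = 0 then 1 else -1) (n N : ℕ) (ε : ℝ) (x z : Fin n → ZMod 2) :
    ∑ a : Fin N → Fin n → ZMod 2, ∑ y : Fin N → ℤˣ,
      (∏ i, (1 + ε * ((y i : ℤ) : ℝ) * χ (∑ j, a i j * x j))) *
        ∏ i, (1 + ε * ((y i : ℤ) : ℝ) * χ (∑ j, a i j * z j))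
      = (2 ^ n * 2) ^ N * (1 + if x = z then (1 + ε ^ 2) ^ N - 1 else 0) := by
  simp_rw [← Finset.prod_mul_distrib]
  rw [sum_sum_prod_eq_pow N fun (v : Fin n → ZMod 2) (u : ℤˣ) =>
    (1 + ε * ((u : ℤ) : ℝ) * χ (∑ j, v j * x j)) * (1 + ε * ((u : ℤ) : ℝ) * χ (∑ j, v j * z j))]
  simp_rw [sum_int_units]
  trans (∑ v : Fin n → ZMod 2,
    ((2 : ℝ) + 2 * ε ^ 2 * (χ (∑ j, v j * x j) * χ (∑ j, v j * z j)))) ^ N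
  · congr 1
    refine Finset.sum_congr rfl fun v _ => ?_
    push_cast
    ring
  · rw [Finset.sum_add_distrib, ← Finset.mul_sum, sum_sign_dot_mul_sign_dot hχ]
    split_ifs
    · rw [add_sub_cancel, ← mul_pow]
      congr 1
      simp
      ring
    · simp

theorem stmt_19 (n N : ℕ) (hn : 1 ≤ n) (hN : 1 ≤ N) (ε : ℝ)
    (χ : ZMod 2 → ℝ) (hχ : ∀ b, χ b = if b = 0 then 1 else -1)
    (err0 : (Fin N → Fin n → ZMod 2) → (Fin N → ℤˣ) → ℝ)
    (herr : ∀ a y, err0 a y =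
      (2:ℝ) ^ (-(n : ℤ)) * (∑ x : Fin n → ZMod 2,
        ∏ i : Fin N, (1 + ε * ((y i : ℤ) : ℝ) * χ (∑ j, a i j * x j))) - 1) :
    (∑ a : Fin N → Fin n → ZMod 2, ∑ y : Fin N → ℤˣ, err0 a y ^ 2)
        / ((Fintype.card (Fin N → Fin n → ZMod 2) : ℝ) *
            (Fintype.card (Fin N → ℤˣ) : ℝ))
      = ((1 + ε ^ 2) ^ N - 1) * (2:ℝ) ^ (-(n : ℤ)) := by
  set F : (Fin N → Fin n → ZMod 2) → (Fin N → ℤˣ) → (Fin n → ZMod 2) → ℝ :=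
    fun a y x => ∏ i : Fin N, (1 + ε * ((y i : ℤ) : ℝ) * χ (∑ j, a i j * x j)) with hF
  have hcard : (Fintype.card (Fin N → Fin n → ZMod 2) : ℝ) *
      (Fintype.card (Fin N → ℤˣ) : ℝ) = (2 ^ n * 2) ^ N := by
    simp [mul_pow]
  have hfirst : ∑ a, ∑ y, ∑ x, F a y x = 2 ^ n * (2 ^ n * 2) ^ N := by
    rw [sum_sum_sum_rotate]
    simp_rw [hF, sum_sum_prod_one_add]
    simp
  have hsecond : ∑ a, ∑ y, (∑ x, F a y x) ^ 2
      = (2 ^ n * 2) ^ N * (2 ^ n * (2 ^ n + ((1 + ε ^ 2) ^ N - 1))) := by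
    have hswap : ∑ a, ∑ y, (∑ x, F a y x) ^ 2
        = ∑ x, ∑ z, ∑ a, ∑ y, F a y x * F a y z := by
      simp_rw [sq, Finset.sum_mul_sum]
      rw [sum_sum_sum_rotate]
      exact Finset.sum_congr rfl fun x _ => sum_sum_sum_rotate _
    rw [hswap]
    simp_rw [hF, sum_sum_prod_one_add_mul hχ, ← Finset.mul_sum, Finset.sum_add_distrib]
    simp
    ring
  have hexpand : ∑ a, ∑ y, err0 a y ^ 2
      = ((2 : ℝ) ^ n)⁻¹ ^ 2 * ∑ a, ∑ y, (∑ x, F a y x) ^ 2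
        - 2 * ((2 : ℝ) ^ n)⁻¹ * ∑ a, ∑ y, ∑ x, F a y x + (2 ^ n * 2) ^ N := by
    have hconst : ((2 : ℝ) ^ n * 2) ^ N
        = ∑ _a : Fin N → Fin n → ZMod 2, ∑ _y : Fin N → ℤˣ, (1 : ℝ) := by
      rw [← hcard]; simp
    rw [hconst]
    simp_rw [Finset.mul_sum (Finset.univ : Finset (Fin N → Fin n → ZMod 2)),
      Finset.mul_sum (Finset.univ : Finset (Fin N → ℤˣ)), ← Finset.sum_sub_distrib,
      ← Finset.sum_add_distrib]
    refine Finset.sum_congr rfl fun a _ => Finset.sum_congr rfl fun y _ => ?_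
    rw [herr, zpow_neg, zpow_natCast]
    ring
  rw [hcard, hexpand, hfirst, hsecond, zpow_neg, zpow_natCast]
  field_simp
  ring
end
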